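/- Let 0 < q, r < ∞ and 1 < p < ∞ with q < p ≤ r, let u, w be weights on (0,∞), and let v be a weight on (0,∞) such that ∫_x^∞ v(t)^{1-p'} dt < ∞ for every x ∈ (0,∞). Then there exists a constant C > 0 such that (∫₀^∞ (∫_x^∞ (∫_t^∞ h(s) ds)^r u(t) dt)^{q/r} w(x) dx)^{1/q} ≤ C (∫₀^∞ h(t)^p v(t) dt)^{1/p} for all h ∈ M⁺(0,∞) if and only if E₂ < ∞ and E₃ < ∞, where E₂ := (∫₀^∞ (∫₀^t w)^{q/(p-q)} w(t) (sup_{x∈(t,∞)} (∫_t^x u)^{1/r} (∫_x^∞ v^{1-p'})^{1/p'})^{pq/(p-q)} dt)^{(p-q)/(pq)} and E₃ := (∫₀^∞ (∫₀^t w(s) (∫_s^t u)^{q/r} ds)^{q/(p-q)} w(t) (sup_{x∈(t,∞)} (∫_t^x u)^{q/r} (∫_x^∞ v^{1-p'})^{(p-1)q/(p-q)}) dt)^{(p-q)/(pq)}. -/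

import Mathlib

open MeasureTheory Set ENNReal NNReal

noncomputable section

/-- Lebesgue measure restricted to `(0, ∞)`. -/
def mu0 : Measure ℝ := volume.restrict (Ioi (0 : ℝ))

/-- A weight on `(0, ∞)`: a measurable function that is positive (and finite) a.e. on `(0, ∞)`. -/
def IsWeight (v : ℝ → ℝ≥0∞) : Prop :=
  Measurable v ∧ ∀ᵐ x ∂mu0, 0 < v x ∧ v x < ∞

section DistributionFunction
open Filter Topology

theorem continuous_real_Iic (μ : Measure ℝ) [IsFiniteMeasure μ] [NullSingletonClass μ] :
    Continuous fun s => μ.real (Iic s) := by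
  rw [continuous_iff_continuousAt]
  intro b
  have h1 : Tendsto (fun s : ℝ => |s - b|) (𝓝 b) (𝓝 0) := by
    have : Continuous fun s : ℝ => |s - b| := by fun_prop
    simpa using this.tendsto b
  have h2 : Tendsto (fun s : ℝ => μ.real (Icc (b - |s - b|) (b + |s - b|))) (𝓝 b) (𝓝 0) := by
    have := (ENNReal.tendsto_toReal zero_ne_top).comp ((tendsto_measure_Icc μ b).comp h1)
    simpa [Measure.real, Function.comp_def] using this
  rw [ContinuousAt, tendsto_iff_norm_sub_tendsto_zero]
  refine squeeze_zero (fun _ => norm_nonneg _) (fun s => ?_) h2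
  rw [Real.norm_eq_abs]
  have key : ∀ x y : ℝ, x ≤ y → μ.real (Iic y) - μ.real (Iic x) = μ.real (Ioc x y) := by
    intro x y hxy
    rw [← Iic_union_Ioc_eq_Iic hxy, measureReal_union (Iic_disjoint_Ioc le_rfl) measurableSet_Ioc]
    ring
  rcases le_total s b with h | h
  · rw [abs_sub_comm, key s b h, abs_of_nonneg measureReal_nonneg, abs_of_nonpos (by linarith)]
    exact measureReal_mono (fun x hx => ⟨by linarith [hx.1], by linarith [hx.2]⟩)
  · rw [key b s h, abs_of_nonneg measureReal_nonneg, abs_of_nonneg (by linarith)]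
    exact measureReal_mono (fun x hx => ⟨by linarith [hx.1], by linarith [hx.2]⟩)

theorem exists_real_Iic_eq (μ : Measure ℝ) [IsFiniteMeasure μ] [NullSingletonClass μ] {c : ℝ}
    (h0 : 0 < c) (h1 : c < μ.real univ) : ∃ s, μ.real (Iic s) = c := by
  have hbot : ∃ s, μ.real (Iic s) ≤ c := by
    have h := (ENNReal.tendsto_toReal (measure_ne_top μ univ)).comp (tendsto_measure_Ici_atBot μ)
    obtain ⟨s, hs⟩ := ((h.eventually (lt_mem_nhds
      (show μ.real univ - c < (μ univ).toReal by simpa [Measure.real] using h0)))).exists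
    refine ⟨s, ?_⟩
    have h2 : μ.real (Iio s) + μ.real (Ici s) = μ.real univ := by
      rw [← measureReal_union (Iio_disjoint_Ici le_rfl) measurableSet_Ici,
        Iio_union_Ici]
    have h3 : μ.real (Iic s) = μ.real (Iio s) := by
      simp only [Measure.real]; rw [measure_congr Iio_ae_eq_Iic]
    change _ < μ.real (Ici s) at hs
    linarith
  have htop : ∃ s, c ≤ μ.real (Iic s) := by
    have h := (ENNReal.tendsto_toReal (measure_ne_top μ univ)).comp (tendsto_measure_Iic_atTop μ)
    obtain ⟨s, hs⟩ := (h.eventually (lt_mem_nhds h1)).exists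
    exact ⟨s, hs.le⟩
  exact mem_range_of_exists_le_of_exists_ge (continuous_real_Iic μ) hbot htop

/-- The distribution function of an atomless finite measure pushes it to Lebesgue measure. -/
theorem map_real_Iic (μ : Measure ℝ) [IsFiniteMeasure μ] [NullSingletonClass μ] :
    μ.map (fun s => μ.real (Iic s)) = volume.restrict (Ioc 0 (μ.real univ)) := by
  have hmono : Monotone fun s => μ.real (Iic s) := fun x y h =>
    measureReal_mono (Iic_subset_Iic.2 h)
  refine Measure.ext_of_Iic _ _ fun a => ?_
  rw [Measure.map_apply hmono.measurable measurableSet_Iic,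
    Measure.restrict_apply measurableSet_Iic]
  rcases lt_or_ge a 0 with ha | ha
  · have h1 : (fun s => μ.real (Iic s)) ⁻¹' Iic a = ∅ := by
      ext s
      simp only [mem_preimage, mem_Iic, mem_empty_iff_false, iff_false, not_le]
      exact ha.trans_le measureReal_nonneg
    have h2 : Iic a ∩ Ioc 0 (μ.real univ) = ∅ := by
      ext s; simp only [mem_inter_iff, mem_Iic, mem_Ioc, mem_empty_iff_false, iff_false]
      intro h; linarith [h.1, h.2.1]
    rw [h1, h2]; simp
  rcases le_or_gt (μ.real univ) a with hT | hT
  · have h1 : (fun s => μ.real (Iic s)) ⁻¹' Iic a = univ := by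
      ext s
      simp only [mem_preimage, mem_Iic, mem_univ, iff_true]
      exact (measureReal_mono (subset_univ _)).trans hT
    have h2 : Iic a ∩ Ioc 0 (μ.real univ) = Ioc 0 (μ.real univ) := by
      apply inter_eq_right.2 fun s hs => hs.2.trans hT
    rw [h1, h2, Real.volume_Ioc]; simp
  have h2 : Iic a ∩ Ioc 0 (μ.real univ) = Ioc 0 a := by
    ext s; simp only [mem_inter_iff, mem_Iic, mem_Ioc]
    constructor
    · rintro ⟨h, h', -⟩; exact ⟨h', h⟩
    · rintro ⟨h, h'⟩; exact ⟨h', h, h'.trans hT.le⟩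
  rw [h2, Real.volume_Ioc, sub_zero]
  have key : μ.real ((fun s => μ.real (Iic s)) ⁻¹' Iic a) = a := by
    apply le_antisymm
    · refine le_of_forall_gt_imp_ge_of_dense fun b hb => ?_
      rcases le_or_gt (μ.real univ) b with hTb | hTb
      · exact (measureReal_mono (subset_univ _)).trans hTb
      · obtain ⟨s, hs⟩ := exists_real_Iic_eq μ (ha.trans_lt hb) hTb
        rw [← hs]
        refine measureReal_mono fun x hx => ?_
        by_contra hxs
        have : μ.real (Iic s) ≤ μ.real (Iic x) := hmono (not_le.1 hxs).le
        have hx' : μ.real (Iic x) ≤ a := hx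
        linarith
    · rcases ha.eq_or_lt with rfl | ha
      · exact measureReal_nonneg
      obtain ⟨s, hs⟩ := exists_real_Iic_eq μ ha hT
      conv_lhs => rw [← hs]
      exact measureReal_mono fun x hx => (hmono hx).trans hs.le
  conv_rhs => rw [← key]
  rw [ofReal_measureReal]

theorem lintegral_comp_real_Iic (μ : Measure ℝ) [IsFiniteMeasure μ] [NullSingletonClass μ]
    {f : ℝ → ℝ≥0∞} (hf : Measurable f) :
    ∫⁻ s, f (μ.real (Iic s)) ∂μ = ∫⁻ y in Ioc 0 (μ.real univ), f y := by
  have hmono : Monotone fun s => μ.real (Iic s) := fun x y h =>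
    measureReal_mono (Iic_subset_Iic.2 h)
  rw [← map_real_Iic, lintegral_map hf hmono.measurable]

end DistributionFunction

section PowerIntegrals

theorem lintegral_Ioc_ofReal_rpow {a b s : ℝ} (ha : 0 ≤ a) (hab : a ≤ b)
    (h : -1 < s ∨ s ≠ -1 ∧ 0 < a) :
    ∫⁻ y in Ioc a b, ENNReal.ofReal y ^ s =
      ENNReal.ofReal ((b ^ (s + 1) - a ^ (s + 1)) / (s + 1)) := by
  have h0 : -1 < s ∨ s ≠ -1 ∧ (0 : ℝ) ∉ uIcc a b := h.imp_right fun h => ⟨h.1, by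
    rw [uIcc_of_le hab]; exact fun h' => not_lt.2 h'.1 h.2⟩
  have hfint : IntervalIntegrable (fun y : ℝ => y ^ s) volume a b := by
    rcases h0 with h0 | h0
    · exact intervalIntegral.intervalIntegrable_rpow' h0
    · exact intervalIntegral.intervalIntegrable_rpow (Or.inr h0.2)
  rw [← integral_rpow h0, intervalIntegral.integral_of_le hab,
    ofReal_integral_eq_lintegral_ofReal
      ((intervalIntegrable_iff_integrableOn_Ioc_of_le hab).1 hfint)]
  · refine setLIntegral_congr_fun measurableSet_Ioc fun y hy => ?_
    exact ENNReal.ofReal_rpow_of_pos (ha.trans_lt hy.1)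
  · filter_upwards [ae_restrict_mem measurableSet_Ioc] with y hy
    exact Real.rpow_nonneg (ha.trans hy.1.le) _

theorem setLIntegral_Iic_comp_real_Iic (μ : Measure ℝ) [NullSingletonClass μ] {t : ℝ}
    (ht : μ (Iic t) ≠ ∞) {f : ℝ → ℝ≥0∞} (hf : Measurable f) :
    ∫⁻ s in Iic t, f (μ.real (Iic s)) ∂μ = ∫⁻ y in Ioc 0 (μ.real (Iic t)), f y := by
  have : IsFiniteMeasure (μ.restrict (Iic t)) := isFiniteMeasure_restrict.2 ht
  have h := lintegral_comp_real_Iic (μ.restrict (Iic t)) hf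
  rw [measureReal_restrict_apply MeasurableSet.univ, univ_inter] at h
  rw [← h]
  refine setLIntegral_congr_fun measurableSet_Iic fun s hs => ?_
  simp only [measureReal_restrict_apply measurableSet_Iic]
  rw [inter_eq_left.2 (Iic_subset_Iic.2 hs)]

theorem setLIntegral_Ioc_comp_real_Iic (μ : Measure ℝ) [NullSingletonClass μ] {b t : ℝ}
    (hbt : b ≤ t) (ht : μ (Iic t) ≠ ∞) {f : ℝ → ℝ≥0∞} (hf : Measurable f) :
    ∫⁻ s in Ioc b t, f (μ.real (Iic s)) ∂μ =
      ∫⁻ y in Ioc (μ.real (Iic b)) (μ.real (Iic t)), f y := by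
  have hmono : ∀ x y : ℝ, x ≤ y → y ≤ t → μ.real (Iic x) ≤ μ.real (Iic y) := fun x y h hy =>
    measureReal_mono (Iic_subset_Iic.2 h)
      (ne_top_of_le_ne_top ht (measure_mono (Iic_subset_Iic.2 hy)))
  set A := μ.real (Iic b) with hA
  have h1 := setLIntegral_Iic_comp_real_Iic μ ht (hf.indicator (measurableSet_Ioi (a := A)))
  have hz := setLIntegral_Iic_comp_real_Iic μ ht
    (measurable_const.indicator (measurableSet_singleton A) : Measurable (({A} : Set ℝ).indicator
      fun _ => (1 : ℝ≥0∞)))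
  have hz0 : ∫⁻ y in Ioc 0 (μ.real (Iic t)),
      ({A} : Set ℝ).indicator (fun _ => (1 : ℝ≥0∞)) y = 0 := by
    rw [lintegral_indicator (measurableSet_singleton A)]; simp
  rw [hz0] at hz
  have e1 : ∫⁻ y in Ioc 0 (μ.real (Iic t)), (Ioi A).indicator f y =
      ∫⁻ y in Ioc A (μ.real (Iic t)), f y := by
    rw [lintegral_indicator measurableSet_Ioi, Measure.restrict_restrict measurableSet_Ioi]
    congr 2
    ext y
    simp only [mem_inter_iff, mem_Ioi, mem_Ioc]
    constructor
    · rintro ⟨h, h', h''⟩; exact ⟨h, h''⟩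
    · rintro ⟨h, h'⟩; exact ⟨h, measureReal_nonneg.trans_lt h, h'⟩
  rw [← e1, ← h1]
  have e2 : Iic t = Iic b ∪ Ioc b t := (Iic_union_Ioc_eq_Iic hbt).symm
  rw [e2, lintegral_union measurableSet_Ioc (Iic_disjoint_Ioc le_rfl)] at hz ⊢
  have e3 : ∫⁻ s in Iic b, (Ioi A).indicator f (μ.real (Iic s)) ∂μ = 0 := by
    rw [setLIntegral_congr_fun (g := fun _ => 0) measurableSet_Iic]
    · simp
    · intro s hs
      exact indicator_of_notMem (not_lt.2 (hmono s b hs hbt)) _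
  rw [e3, zero_add]
  have hz' := (add_eq_zero.1 hz).2
  have hmeas : Measurable fun s => μ.real (Iic (min s t)) :=
    Monotone.measurable fun x y h => hmono _ _ (min_le_min_right t h) (min_le_right _ _)
  have hz2 : ∫⁻ s in Ioc b t, ({A} : Set ℝ).indicator (fun _ => (1 : ℝ≥0∞))
      (μ.real (Iic (min s t))) ∂μ = 0 := by
    rw [← hz']
    refine setLIntegral_congr_fun measurableSet_Ioc fun s hs => ?_
    simp only [min_eq_left hs.2]
  have hmeas' : Measurable fun s => ({A} : Set ℝ).indicator (fun _ => (1 : ℝ≥0∞))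
      (μ.real (Iic (min s t))) :=
    (measurable_const.indicator (measurableSet_singleton A)).comp hmeas
  rw [lintegral_eq_zero_iff hmeas'] at hz2
  refine lintegral_congr_ae ?_
  filter_upwards [hz2, ae_restrict_mem measurableSet_Ioc] with s hs hs'
  rw [min_eq_left hs'.2] at hs
  have h3 : A ≤ μ.real (Iic s) := hmono b s hs'.1.le hs'.2
  have h4 : μ.real (Iic s) ≠ A := by
    intro h4
    simp [h4] at hs
  exact (indicator_of_mem (show μ.real (Iic s) ∈ Ioi A from lt_of_le_of_ne h3 h4.symm) f).symm

variable (μ : Measure ℝ) [NullSingletonClass μ]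

theorem mul_setLIntegral_Iic_rpow {t γ : ℝ} (hγ : 0 < γ) (ht : μ (Iic t) ≠ ∞) :
    ENNReal.ofReal γ * ∫⁻ s in Iic t, μ (Iic s) ^ (γ - 1) ∂μ = μ (Iic t) ^ γ := by
  have h := setLIntegral_Iic_comp_real_Iic μ ht (f := fun y => ENNReal.ofReal y ^ (γ - 1))
    (by fun_prop)
  rw [lintegral_Ioc_ofReal_rpow le_rfl measureReal_nonneg (Or.inl (by linarith)),
    setLIntegral_congr_fun (g := fun s => μ (Iic s) ^ (γ - 1)) measurableSet_Iic] at h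
  · rw [h, sub_add_cancel, Real.zero_rpow hγ.ne', sub_zero, ← ENNReal.ofReal_mul hγ.le,
      mul_div_cancel₀ _ hγ.ne', ← ENNReal.ofReal_rpow_of_nonneg measureReal_nonneg hγ.le,
      ofReal_measureReal ht]
  · intro s hs
    dsimp only
    rw [ofReal_measureReal (ne_top_of_le_ne_top ht (measure_mono (Iic_subset_Iic.2 hs)))]

theorem rpow_add_mul_setLIntegral_Ioc_rpow {b t γ : ℝ} (hγ : 0 < γ) (hbt : b ≤ t)
    (ht : μ (Iic t) ≠ ∞) :
    μ (Iic b) ^ γ + ENNReal.ofReal γ * ∫⁻ s in Ioc b t, μ (Iic s) ^ (γ - 1) ∂μ =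
      μ (Iic t) ^ γ := by
  rw [← mul_setLIntegral_Iic_rpow μ hγ ht, ← mul_setLIntegral_Iic_rpow μ hγ
    (ne_top_of_le_ne_top ht (measure_mono (Iic_subset_Iic.2 hbt))), ← mul_add,
    ← lintegral_union measurableSet_Ioc (Iic_disjoint_Ioc le_rfl), Iic_union_Ioc_eq_Iic hbt]

theorem rpow_neg_add_mul_setLIntegral_Ioc_rpow {b t γ : ℝ} (hγ : 0 < γ) (hbt : b ≤ t)
    (hb : μ (Iic b) ≠ 0) (ht : μ (Iic t) ≠ ∞) :
    μ (Iic t) ^ (-γ) + ENNReal.ofReal γ * ∫⁻ s in Ioc b t, μ (Iic s) ^ (-γ - 1) ∂μ =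
      μ (Iic b) ^ (-γ) := by
  have hb' : μ (Iic b) ≠ ∞ := ne_top_of_le_ne_top ht (measure_mono (Iic_subset_Iic.2 hbt))
  have h := setLIntegral_Ioc_comp_real_Iic μ hbt ht
    (f := fun y => ENNReal.ofReal y ^ (-γ - 1)) (by fun_prop)
  have hbp : 0 < μ.real (Iic b) := ENNReal.toReal_pos hb hb'
  have hle : μ.real (Iic b) ≤ μ.real (Iic t) := measureReal_mono (Iic_subset_Iic.2 hbt) ht
  rw [lintegral_Ioc_ofReal_rpow hbp.le hle (Or.inr ⟨by linarith, hbp⟩),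
    setLIntegral_congr_fun (g := fun s => μ (Iic s) ^ (-γ - 1)) measurableSet_Ioc] at h
  · rw [h, sub_add_cancel, ← ENNReal.ofReal_mul hγ.le, ← ofReal_measureReal ht,
      ← ofReal_measureReal hb', ENNReal.ofReal_rpow_of_pos hbp,
      ENNReal.ofReal_rpow_of_pos (hbp.trans_le hle), ← ENNReal.ofReal_add]
    · congr 1; field_simp; ring
    · positivity
    · have h1 := Real.rpow_le_rpow_of_nonpos hbp hle (neg_nonpos.2 hγ.le)
      rw [mul_div_assoc', neg_eq_neg_one_mul γ, mul_comm (-1) γ, mul_div_mul_left _ _ hγ.ne',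
        div_neg, div_one, mul_neg_one]
      linarith
  · intro s hs
    dsimp only
    rw [ofReal_measureReal (ne_top_of_le_ne_top ht (measure_mono (Iic_subset_Iic.2 hs.2)))]

theorem mul_setLIntegral_Ioi_rpow_neg_le {b γ : ℝ} (hγ : 0 < γ) (hb : μ (Iic b) ≠ 0)
    (hfin : ∀ t, μ (Iic t) ≠ ∞) :
    ENNReal.ofReal γ * ∫⁻ s in Ioi b, μ (Iic s) ^ (-γ - 1) ∂μ ≤ μ (Iic b) ^ (-γ) := by
  have hU : Ioi b = ⋃ n : ℕ, Ioc b (b + n) := by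
    ext x
    simp only [mem_Ioi, mem_iUnion, mem_Ioc]
    refine ⟨fun h => ?_, fun ⟨_, h, _⟩ => h⟩
    obtain ⟨n, hn⟩ := exists_nat_ge (x - b)
    exact ⟨n, h, by linarith⟩
  have hm : Monotone fun n : ℕ => Ioc b (b + n) := fun m n h =>
    Ioc_subset_Ioc_right (by gcongr)
  rw [hU, setLIntegral_iUnion_of_directed _ hm.directed_le, ENNReal.mul_iSup]
  refine iSup_le fun n => ?_
  rw [← rpow_neg_add_mul_setLIntegral_Ioc_rpow μ hγ (by simp : b ≤ b + n) hb (hfin _)]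
  exact le_add_self

instance (ν : Measure ℝ) [NullSingletonClass ν] : NullSingletonClass (ν.map Neg.neg) where
  measure_singleton x := by
    rw [Measure.map_apply measurable_neg (measurableSet_singleton x)]
    rw [show Neg.neg ⁻¹' {x} = {-x} by ext y; simp]
    exact measure_singleton _

theorem map_neg_Iic (s : ℝ) : (μ.map Neg.neg) (Iic (-s)) = μ (Ioi s) := by
  rw [Measure.map_apply measurable_neg measurableSet_Iic,
    show Neg.neg ⁻¹' Iic (-s) = Ici s by ext y; simp]
  exact measure_congr Ioi_ae_eq_Ici.symm

omit [NullSingletonClass μ] in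
theorem setLIntegral_map_neg (S : Set ℝ) (f : ℝ → ℝ≥0∞) :
    ∫⁻ s in S, f s ∂(μ.map Neg.neg) = ∫⁻ s in Neg.neg ⁻¹' S, f (-s) ∂μ := by
  have h : MeasurableEmbedding (Neg.neg : ℝ → ℝ) := (MeasurableEquiv.neg ℝ).measurableEmbedding
  rw [h.restrict_map, h.lintegral_map]

theorem mul_setLIntegral_Ioi_rpow {t γ : ℝ} (hγ : 0 < γ) (ht : μ (Ioi t) ≠ ∞) :
    ENNReal.ofReal γ * ∫⁻ s in Ioi t, μ (Ioi s) ^ (γ - 1) ∂μ = μ (Ioi t) ^ γ := by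
  have h := mul_setLIntegral_Iic_rpow (μ.map Neg.neg) hγ (t := -t) (by rwa [map_neg_Iic])
  rw [setLIntegral_map_neg, map_neg_Iic, show Neg.neg ⁻¹' Iic (-t) = Ici t by ext y; simp] at h
  simp only [map_neg_Iic] at h
  rwa [setLIntegral_congr Ioi_ae_eq_Ici]

theorem mul_setLIntegral_Ioo_rpow_neg_le {b γ : ℝ} (hγ : 0 < γ) (hb : μ (Ioi b) ≠ 0)
    (hfin : ∀ t, 0 < t → μ (Ioi t) ≠ ∞) :
    ENNReal.ofReal γ * ∫⁻ s in Ioo 0 b, μ (Ioi s) ^ (-γ - 1) ∂μ ≤ μ (Ioi b) ^ (-γ) := by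
  have hU : Ioo 0 b = ⋃ n : ℕ, Ico (1 / ((n : ℝ) + 1)) b := by
    ext x
    simp only [mem_Ioo, mem_iUnion, mem_Ico]
    constructor
    · rintro ⟨h, h'⟩
      obtain ⟨n, hn⟩ := exists_nat_one_div_lt h
      exact ⟨n, hn.le, h'⟩
    · rintro ⟨n, h, h'⟩
      exact ⟨Nat.one_div_pos_of_nat.trans_le h, h'⟩
  have hm : Monotone fun n : ℕ => Ico (1 / ((n : ℝ) + 1)) b := fun m n h =>
    Ico_subset_Ico_left (Nat.one_div_le_one_div h)
  rw [hU, setLIntegral_iUnion_of_directed _ hm.directed_le, ENNReal.mul_iSup]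
  refine iSup_le fun n => ?_
  have hn : 0 < 1 / ((n : ℝ) + 1) := Nat.one_div_pos_of_nat
  generalize 1 / ((n : ℝ) + 1) = ε at hn
  rcases le_or_gt b ε with h | h
  · rw [Ico_eq_empty (not_lt.2 h)]; simp
  have key := rpow_neg_add_mul_setLIntegral_Ioc_rpow (μ.map Neg.neg) hγ (neg_le_neg h.le)
    (by rwa [map_neg_Iic]) (by rw [map_neg_Iic]; exact hfin _ hn)
  rw [setLIntegral_map_neg, map_neg_Iic, map_neg_Iic,
    show Neg.neg ⁻¹' Ioc (-b) (-ε) = Ico ε b by ext y; simp] at key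
  simp only [map_neg_Iic] at key
  rw [← key]
  exact le_add_self

end PowerIntegrals

section Kernels

/-- A measure on `ℝ` carried by `(0, ∞)` and charging every nondegenerate interval
of `(0, ∞)`. -/
structure IsPositiveOnIoi (μ : Measure ℝ) : Prop where
  Iic_zero : μ (Iic 0) = 0
  Ioc_ne_zero : ∀ ⦃a b : ℝ⦄, 0 ≤ a → a < b → μ (Ioc a b) ≠ 0

/-- The function `t ↦ ∫_{(-∞, t]} μ((s, t])^α dω(s)`. -/
def kernelPrimitive (ω μ : Measure ℝ) (α t : ℝ) : ℝ≥0∞ :=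
  ∫⁻ s in Iic t, μ (Ioc s t) ^ α ∂ω

/-- The function `t ↦ sup_{y > t} μ((t, y])^α φ(y)`. -/
def kernelSup (μ : Measure ℝ) (α : ℝ) (φ : ℝ → ℝ≥0∞) (t : ℝ) : ℝ≥0∞ :=
  ⨆ y ∈ Ioi t, μ (Ioc t y) ^ α * φ y

variable {ω μ ν : Measure ℝ} {α θ : ℝ} {φ : ℝ → ℝ≥0∞}

theorem IsPositiveOnIoi.ae_pos (h : IsPositiveOnIoi μ) : ∀ᵐ x ∂μ, 0 < x := by
  have := measure_eq_zero_iff_ae_notMem.1 h.Iic_zero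
  filter_upwards [this] with x hx
  simpa using hx

theorem IsPositiveOnIoi.Iic_ne_zero (h : IsPositiveOnIoi μ) {t : ℝ} (ht : 0 < t) :
    μ (Iic t) ≠ 0 := fun h0 =>
  h.Ioc_ne_zero le_rfl ht (measure_mono_null Ioc_subset_Iic_self h0)

theorem IsPositiveOnIoi.Ioi_ne_zero (h : IsPositiveOnIoi μ) (t : ℝ) : μ (Ioi t) ≠ 0 := fun h0 =>
  h.Ioc_ne_zero (a := max t 0) (le_max_right _ _) (lt_add_one _)
    (measure_mono_null (fun _ hx => (le_max_left _ _).trans_lt hx.1) h0)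

theorem kernelSup_antitone (hα : 0 ≤ α) : Antitone (kernelSup μ α φ) := fun _ _ hst =>
  iSup₂_le fun y hy => (mul_le_mul_left (ENNReal.rpow_le_rpow
    (measure_mono (Ioc_subset_Ioc_left hst)) hα) _).trans
      (le_iSup₂ (f := fun y _ => μ (Ioc _ y) ^ α * φ y) y (hst.trans_lt hy))

theorem measurable_kernelSup (hα : 0 ≤ α) : Measurable (kernelSup μ α φ) :=
  (kernelSup_antitone hα).measurable

theorem le_kernelSup {t y : ℝ} (h : t < y) : μ (Ioc t y) ^ α * φ y ≤ kernelSup μ α φ t :=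
  le_iSup₂ (f := fun y _ => μ (Ioc t y) ^ α * φ y) y h

theorem measurable_measure_Ioc (μ : Measure ℝ) [SFinite μ] :
    Measurable fun z : ℝ × ℝ => μ (Ioc z.1 z.2) := by
  have : MeasurableSet ({z : (ℝ × ℝ) × ℝ | z.1.1 < z.2} ∩ {z | z.2 ≤ z.1.2}) :=
    (measurableSet_lt measurable_fst.fst measurable_snd).inter
      (measurableSet_le measurable_snd measurable_fst.snd)
  exact measurable_measure_prodMk_left this

theorem kernelPrimitive_mono (hα : 0 ≤ α) : Monotone (kernelPrimitive ω μ α) := fun _ _ hst =>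
  (lintegral_mono fun _ => ENNReal.rpow_le_rpow (measure_mono (Ioc_subset_Ioc_right hst)) hα).trans
    (lintegral_mono_set (Iic_subset_Iic.2 hst))

theorem measurable_kernelPrimitive (hα : 0 ≤ α) : Measurable (kernelPrimitive ω μ α) :=
  (kernelPrimitive_mono hα).measurable

theorem measurable_measure_Iic (ω : Measure ℝ) : Measurable fun t => ω (Iic t) :=
  Monotone.measurable fun _ _ h => measure_mono (Iic_subset_Iic.2 h)

theorem measurable_measure_Ioi (ω : Measure ℝ) : Measurable fun t => ω (Ioi t) :=
  Antitone.measurable fun _ _ h => measure_mono (Ioi_subset_Ioi h)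

theorem ENNReal.add_rpow_le_two_rpow_mul (a b : ℝ≥0∞) (hθ : 0 ≤ θ) :
    (a + b) ^ θ ≤ 2 ^ θ * (a ^ θ + b ^ θ) := by
  calc (a + b) ^ θ ≤ (2 * max a b) ^ θ := ENNReal.rpow_le_rpow (by
        rw [two_mul]; exact add_le_add (le_max_left _ _) (le_max_right _ _)) hθ
    _ = 2 ^ θ * max a b ^ θ := ENNReal.mul_rpow_of_nonneg _ _ hθ
    _ ≤ _ := by
      gcongr
      rcases max_choice a b with h | h <;> rw [h]
      exacts [le_self_add, le_add_self]

theorem measure_Ioc_rpow_le_add (hα : 0 ≤ α) (hα1 : α ≤ 1) {a b c : ℝ} (hab : a ≤ b)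
    (hbc : b ≤ c) : μ (Ioc a c) ^ α ≤ μ (Ioc a b) ^ α + μ (Ioc b c) ^ α := by
  rw [← Ioc_union_Ioc_eq_Ioc hab hbc]
  exact (ENNReal.rpow_le_rpow (measure_union_le _ _) hα).trans
    (ENNReal.rpow_add_le_add_rpow _ _ hα hα1)

theorem lintegral_lintegral_Ioi_swap [SFinite ω] [SFinite ν] {f : ℝ → ℝ → ℝ≥0∞}
    (hf : Measurable (Function.uncurry f)) :
    ∫⁻ x, ∫⁻ y in Ioi x, f x y ∂ν ∂ω = ∫⁻ y, ∫⁻ x in Iio y, f x y ∂ω ∂ν := by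
  have hm : Measurable ({z : ℝ × ℝ | z.1 < z.2}.indicator (Function.uncurry f)) :=
    hf.indicator (measurableSet_lt measurable_fst measurable_snd)
  have := lintegral_lintegral_swap (μ := ω) (ν := ν)
    (f := fun x y => {z : ℝ × ℝ | z.1 < z.2}.indicator (Function.uncurry f) (x, y))
    hm.aemeasurable
  simp only [← lintegral_indicator measurableSet_Ioi, ← lintegral_indicator measurableSet_Iio]
  exact this

end Kernels

section IterationBound

variable {ω μ ν : Measure ℝ} {α θ : ℝ} {φ : ℝ → ℝ≥0∞}

theorem kernelPrimitive_le_setLIntegral (hα : 0 ≤ α) {τ y : ℝ} (h : τ ≤ y) :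
    kernelPrimitive ω μ α τ ≤ ∫⁻ b in Iic τ, μ (Ioc b y) ^ α ∂ω :=
  lintegral_mono fun _ => ENNReal.rpow_le_rpow (measure_mono (Ioc_subset_Ioc_right h)) hα

theorem mul_rpow_le_setLIntegral (hα : 0 ≤ α) (τ y : ℝ) :
    ω (Iic τ) * μ (Ioc τ y) ^ α ≤ ∫⁻ b in Iic τ, μ (Ioc b y) ^ α ∂ω := by
  rw [mul_comm, ← setLIntegral_const]
  exact setLIntegral_mono' measurableSet_Iic fun b hb =>
    ENNReal.rpow_le_rpow (measure_mono (Ioc_subset_Ioc_left hb)) hα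

theorem setLIntegral_le_kernelPrimitive_add (hα : 0 ≤ α) (hα1 : α ≤ 1) {τ y : ℝ} (h : τ ≤ y) :
    ∫⁻ b in Iic τ, μ (Ioc b y) ^ α ∂ω ≤
      kernelPrimitive ω μ α τ + ω (Iic τ) * μ (Ioc τ y) ^ α := by
  rw [mul_comm, ← setLIntegral_const, kernelPrimitive, ← lintegral_add_right _ measurable_const]
  exact setLIntegral_mono' measurableSet_Iic fun b hb => measure_Ioc_rpow_le_add hα hα1 hb h

theorem kernelPrimitive_ne_zero [SFinite μ] (hω : IsPositiveOnIoi ω) (hμ : IsPositiveOnIoi μ)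
    (hα : 0 < α) {t : ℝ} (ht : 0 < t) : kernelPrimitive ω μ α t ≠ 0 := by
  have h : ω (Iic (t / 2)) * μ (Ioc (t / 2) t) ^ α ≤ kernelPrimitive ω μ α t :=
    (mul_rpow_le_setLIntegral hα.le _ _).trans (lintegral_mono_set (Iic_subset_Iic.2 (by linarith)))
  refine ne_of_gt (lt_of_lt_of_le (pos_iff_ne_zero.2 (mul_ne_zero
    (hω.Iic_ne_zero (by linarith)) ?_)) h)
  have := hμ.Ioc_ne_zero (a := t / 2) (b := t) (by linarith) (by linarith)
  simp [ENNReal.rpow_eq_zero_iff, this, hα.not_gt]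

/-- The quantity whose integral is finite exactly when both characteristic quantities are. -/
def sufficiencyDensity (ω μ : Measure ℝ) (α θ : ℝ) (φ : ℝ → ℝ≥0∞) (t : ℝ) : ℝ≥0∞ :=
  kernelPrimitive ω μ α t ^ θ * kernelSup μ α φ t +
    ω (Iic t) ^ θ * kernelSup μ (α * (1 + θ)) φ t

theorem measurable_sufficiencyDensity (hα : 0 ≤ α) (hθ : 0 ≤ θ) :
    Measurable (sufficiencyDensity ω μ α θ φ) :=
  (((measurable_kernelPrimitive hα).pow_const _).mul (measurable_kernelSup hα)).add
    (((measurable_measure_Iic ω).pow_const _).mul (measurable_kernelSup (by positivity)))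

theorem setLIntegral_rpow_mul_le_sufficiencyDensity (hα : 0 ≤ α) (hα1 : α ≤ 1) (hθ : 0 ≤ θ)
    {τ y : ℝ} (h : τ < y) :
    (∫⁻ b in Iic τ, μ (Ioc b y) ^ α ∂ω) ^ θ * (μ (Ioc τ y) ^ α * φ y) ≤
      2 ^ θ * sufficiencyDensity ω μ α θ φ τ := by
  have h2 : ω (Iic τ) ^ θ * (μ (Ioc τ y) ^ (α * (1 + θ)) * φ y) =
      (ω (Iic τ) * μ (Ioc τ y) ^ α) ^ θ * (μ (Ioc τ y) ^ α * φ y) := by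
    rw [ENNReal.mul_rpow_of_nonneg _ _ hθ, ← ENNReal.rpow_mul, mul_add, mul_one,
      ENNReal.rpow_add_of_nonneg _ _ hα (by positivity)]
    ring
  calc _ ≤ (kernelPrimitive ω μ α τ + ω (Iic τ) * μ (Ioc τ y) ^ α) ^ θ *
        (μ (Ioc τ y) ^ α * φ y) := by
        gcongr
        exact setLIntegral_le_kernelPrimitive_add hα hα1 h.le
    _ ≤ 2 ^ θ * (kernelPrimitive ω μ α τ ^ θ + (ω (Iic τ) * μ (Ioc τ y) ^ α) ^ θ) *
        (μ (Ioc τ y) ^ α * φ y) := by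
        gcongr
        exact ENNReal.add_rpow_le_two_rpow_mul _ _ hθ
    _ = 2 ^ θ * (kernelPrimitive ω μ α τ ^ θ * (μ (Ioc τ y) ^ α * φ y) +
        ω (Iic τ) ^ θ * (μ (Ioc τ y) ^ (α * (1 + θ)) * φ y)) := by rw [h2]; ring
    _ ≤ _ := by
        rw [sufficiencyDensity]
        gcongr
        exacts [le_kernelSup h, le_kernelSup h]

theorem kernelSup_kernelPrimitive_le [SFinite ω] [NullSingletonClass ω] [SFinite μ]
    (hω : IsPositiveOnIoi ω) (hμ : IsPositiveOnIoi μ) (hα : 0 < α) (hα1 : α ≤ 1) (hθ : 0 < θ)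
    (hS : ∀ t, kernelPrimitive ω μ α t ≠ ∞) {s : ℝ} (hs : 0 < s) :
    kernelSup μ α (fun y => kernelPrimitive ω μ α y ^ θ * φ y) s ≤
      2 ^ θ * sufficiencyDensity ω μ α θ φ s + ENNReal.ofReal θ * 2 ^ θ * ∫⁻ τ in Ioi s,
        (μ (Ioc s τ) ^ α * (kernelPrimitive ω μ α τ)⁻¹ + (ω (Iic τ))⁻¹) *
          sufficiencyDensity ω μ α θ φ τ ∂ω := by
  refine iSup₂_le fun y (hy : s < y) => ?_
  have hmeas : Measurable fun b => μ (Ioc b y) ^ α :=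
    ((measurable_measure_Ioc μ).comp measurable_prodMk_right).pow_const α
  set ωy := ω.withDensity fun b => μ (Ioc b y) ^ α with hωy
  have hωyI : ∀ τ, ωy (Iic τ) = ∫⁻ b in Iic τ, μ (Ioc b y) ^ α ∂ω := fun τ =>
    withDensity_apply _ measurableSet_Iic
  have hchain := rpow_add_mul_setLIntegral_Ioc_rpow ωy hθ hy.le (by rw [hωyI]; exact hS y)
  rw [hωyI y] at hchain
  change _ = kernelPrimitive ω μ α y ^ θ at hchain
  rw [hωyI s, hωy, setLIntegral_withDensity_eq_setLIntegral_mul _ hmeas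
    ((measurable_measure_Iic _).pow_const _) measurableSet_Ioc, ← hωy] at hchain
  beta_reduce
  rw [← hchain]
  have hcomm : ∀ a b c d e : ℝ≥0∞, a * ((b + e * c) * d) = b * (a * d) + e * (a * d * c) := by
    intros; ring
  rw [hcomm, mul_assoc (ENNReal.ofReal θ)]
  refine add_le_add (setLIntegral_rpow_mul_le_sufficiencyDensity hα.le hα1 hθ.le hy)
    (mul_le_mul_right ?_ _)
  rw [← lintegral_const_mul _ (hmeas.mul ((measurable_measure_Iic _).pow_const _)),
    ← lintegral_const_mul']
  swap
  · exact (ENNReal.rpow_lt_top_of_nonneg hθ.le (by simp)).ne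
  refine (setLIntegral_mono' measurableSet_Ioc fun τ hτ => ?_).trans
    (lintegral_mono_set Ioc_subset_Ioi_self)
  rcases hτ.2.eq_or_lt with rfl | hτy
  · simp [hα]
  have hτ0 : 0 < τ := hs.trans hτ.1
  simp only [Pi.mul_apply, hωyI]
  have hb := setLIntegral_rpow_mul_le_sufficiencyDensity (ω := ω) (μ := μ) (φ := φ) hα.le hα1 hθ.le
    hτy
  have hle1 := kernelPrimitive_le_setLIntegral (ω := ω) (μ := μ) hα.le hτy.le
  have hle2 := mul_rpow_le_setLIntegral (ω := ω) (μ := μ) hα.le τ y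
  have hne0 := kernelPrimitive_ne_zero hω hμ hα hτ0
  have hSt := hS y
  have hle3 : ∫⁻ b in Iic τ, μ (Ioc b y) ^ α ∂ω ≤ kernelPrimitive ω μ α y :=
    lintegral_mono_set (Iic_subset_Iic.2 hτy.le)
  set P := ∫⁻ b in Iic τ, μ (Ioc b y) ^ α ∂ω
  have hP0 : P ≠ 0 := fun h => hne0 (le_zero_iff.1 (h ▸ hle1))
  have hPt : P ≠ ∞ := ne_top_of_le_ne_top hSt hle3
  have hPP : P ^ (θ - 1) = P ^ θ * P⁻¹ := by
    rw [sub_eq_add_neg, ENNReal.rpow_add _ _ hP0 hPt, ENNReal.rpow_neg_one]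
  calc μ (Ioc s y) ^ α * φ y * (μ (Ioc τ y) ^ α * P ^ (θ - 1))
      ≤ (μ (Ioc s τ) ^ α + μ (Ioc τ y) ^ α) * φ y * (μ (Ioc τ y) ^ α * P ^ (θ - 1)) := by
        gcongr
        exact measure_Ioc_rpow_le_add hα.le hα1 hτ.1.le hτy.le
    _ = (μ (Ioc s τ) ^ α * P⁻¹ + μ (Ioc τ y) ^ α * P⁻¹) *
        (P ^ θ * (μ (Ioc τ y) ^ α * φ y)) := by rw [hPP]; ring
    _ ≤ (μ (Ioc s τ) ^ α * (kernelPrimitive ω μ α τ)⁻¹ + (ω (Iic τ))⁻¹) *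
        (2 ^ θ * sufficiencyDensity ω μ α θ φ τ) := by
        gcongr
        rw [ENNReal.le_inv_iff_mul_le, mul_comm, ← mul_assoc]
        exact (mul_le_mul_left hle2 _).trans (ENNReal.mul_inv_cancel hP0 hPt).le
    _ = _ := by ring

theorem lintegral_kernelSup_kernelPrimitive_le [SFinite ω] [NullSingletonClass ω] [SFinite μ]
    (hω : IsPositiveOnIoi ω) (hμ : IsPositiveOnIoi μ) (hα : 0 < α) (hα1 : α ≤ 1) (hθ : 0 < θ)
    (hS : ∀ t, kernelPrimitive ω μ α t ≠ ∞) :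
    ∫⁻ s, kernelSup μ α (fun y => kernelPrimitive ω μ α y ^ θ * φ y) s ∂ω ≤
      2 ^ θ * (1 + 2 * ENNReal.ofReal θ) * ∫⁻ s, sufficiencyDensity ω μ α θ φ s ∂ω := by
  have hR := measurable_sufficiencyDensity (ω := ω) (μ := μ) (φ := φ) hα.le hθ.le
  set R := sufficiencyDensity ω μ α θ φ
  have hSm := measurable_kernelPrimitive (ω := ω) (μ := μ) hα.le
  have hk : Measurable (Function.uncurry fun s τ => (μ (Ioc s τ) ^ α *
      (kernelPrimitive ω μ α τ)⁻¹ + (ω (Iic τ))⁻¹) * R τ) :=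
    ((((measurable_measure_Ioc μ).pow_const α).mul (hSm.comp measurable_snd).inv).add
      ((measurable_measure_Iic ω).comp measurable_snd).inv).mul (hR.comp measurable_snd)
  have hswap : ∫⁻ s, ∫⁻ τ in Ioi s, (μ (Ioc s τ) ^ α * (kernelPrimitive ω μ α τ)⁻¹ +
      (ω (Iic τ))⁻¹) * R τ ∂ω ∂ω ≤ 2 * ∫⁻ s, R s ∂ω := by
    rw [lintegral_lintegral_Ioi_swap hk, ← lintegral_const_mul _ hR]
    refine lintegral_mono fun τ => ?_
    rw [setLIntegral_congr Iio_ae_eq_Iic, lintegral_mul_const]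
    swap
    · exact (((measurable_measure_Ioc μ).comp measurable_prodMk_right).pow_const α).mul_const _
        |>.add_const _
    rw [lintegral_add_right _ measurable_const, lintegral_mul_const, setLIntegral_const]
    swap
    · exact ((measurable_measure_Ioc μ).comp measurable_prodMk_right).pow_const α
    gcongr
    rw [← one_add_one_eq_two]
    refine add_le_add ?_ ?_
    · exact ENNReal.mul_inv_le_one _
    · rw [mul_comm]; exact ENNReal.mul_inv_le_one _
  calc _ ≤ ∫⁻ s, (2 ^ θ * R s + ENNReal.ofReal θ * 2 ^ θ * ∫⁻ τ in Ioi s,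
        (μ (Ioc s τ) ^ α * (kernelPrimitive ω μ α τ)⁻¹ + (ω (Iic τ))⁻¹) * R τ ∂ω) ∂ω := by
        refine lintegral_mono_ae ?_
        filter_upwards [hω.ae_pos] with s hs
        exact kernelSup_kernelPrimitive_le hω hμ hα hα1 hθ hS hs
    _ = 2 ^ θ * ∫⁻ s, R s ∂ω + ENNReal.ofReal θ * 2 ^ θ * ∫⁻ s, ∫⁻ τ in Ioi s,
        (μ (Ioc s τ) ^ α * (kernelPrimitive ω μ α τ)⁻¹ + (ω (Iic τ))⁻¹) * R τ ∂ω ∂ω := by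
        have h2 : (2 : ℝ≥0∞) ^ θ ≠ ∞ := (ENNReal.rpow_lt_top_of_nonneg hθ.le (by simp)).ne
        rw [lintegral_add_left (hR.const_mul _), lintegral_const_mul _ hR, lintegral_const_mul']
        exact ENNReal.mul_ne_top ENNReal.ofReal_ne_top h2
    _ ≤ 2 ^ θ * ∫⁻ s, R s ∂ω + ENNReal.ofReal θ * 2 ^ θ * (2 * ∫⁻ s, R s ∂ω) := by gcongr
    _ = _ := by ring

end IterationBound

section Hardy

variable {μ ν : Measure ℝ}

theorem lintegral_tail_rpow_mul_le [SFinite ν] [NullSingletonClass ν] (hν : IsPositiveOnIoi ν)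
    (hV : ∀ x, 0 < x → ν (Ioi x) ≠ ∞) {p : ℝ} (hp : 1 < p) {m : ℝ → ℝ≥0∞} (hm : Measurable m) :
    ∫⁻ s, (∫⁻ t in Ioi s, m t ∂ν) ^ p * ν (Ioi s) ^ (-p) ∂ν ≤
      ENNReal.ofReal ((p - 1) / p) ^ (-p) * ∫⁻ t, m t ^ p ∂ν := by
  have hp0 : 0 < p := by linarith
  set a := (p - 1) / p with ha
  have ha0 : 0 < a := div_pos (by linarith) hp0
  have hpq : p.HolderConjugate (p / (p - 1)) := Real.HolderConjugate.conjExponent hp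
  have hVm := measurable_measure_Ioi ν
  have hA0 : ENNReal.ofReal a ≠ 0 := by simpa using ha0
  have hAt : ENNReal.ofReal a ≠ ∞ := ENNReal.ofReal_ne_top
  have hpoint : ∀ s, 0 < s → (∫⁻ t in Ioi s, m t ∂ν) ^ p * ν (Ioi s) ^ (-p) ≤
      ENNReal.ofReal a ^ (-(p - 1)) *
        ∫⁻ t in Ioi s, ν (Ioi s) ^ (-a - 1) * (m t ^ p * ν (Ioi t) ^ a) ∂ν := by
    intro s hs
    have h1 : ∫⁻ t in Ioi s, m t ∂ν ≤ (∫⁻ t in Ioi s, m t ^ p * ν (Ioi t) ^ a ∂ν) ^ (1 / p) *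
        (∫⁻ t in Ioi s, ν (Ioi t) ^ (a - 1) ∂ν) ^ (1 / (p / (p - 1))) := by
      have := ENNReal.lintegral_mul_le_Lp_mul_Lq (ν.restrict (Ioi s)) hpq
        (f := fun t => m t * ν (Ioi t) ^ (a / p)) (g := fun t => ν (Ioi t) ^ (-(a / p)))
        (hm.mul (hVm.pow_const _)).aemeasurable (hVm.pow_const _).aemeasurable
      refine le_trans (le_of_eq ?_) (this.trans (le_of_eq ?_))
      · refine setLIntegral_congr_fun measurableSet_Ioi fun t ht => ?_
        have h0 := hν.Ioi_ne_zero t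
        have ht := hV t (hs.trans ht)
        simp only [Pi.mul_apply]
        rw [mul_assoc, ← ENNReal.rpow_add _ _ h0 ht, add_neg_cancel, ENNReal.rpow_zero, mul_one]
      · congr 3
        · ext t
          rw [ENNReal.mul_rpow_of_nonneg _ _ hp0.le, ← ENNReal.rpow_mul, div_mul_cancel₀ _ hp0.ne']
        · ext t
          rw [← ENNReal.rpow_mul]
          congr 1
          have hp1 : p - 1 ≠ 0 := by linarith
          rw [ha]
          field_simp
          ring
    have h2 : ∫⁻ t in Ioi s, ν (Ioi t) ^ (a - 1) ∂ν =
        (ENNReal.ofReal a)⁻¹ * ν (Ioi s) ^ a := by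
      rw [← mul_setLIntegral_Ioi_rpow ν ha0 (hV s hs), ← mul_assoc,
        ENNReal.inv_mul_cancel hA0 hAt, one_mul]
    rw [h2] at h1
    have h0 := hν.Ioi_ne_zero s
    have ht := hV s hs
    have hVam : Measurable fun t => m t ^ p * ν (Ioi t) ^ a :=
      (hm.pow_const _).mul (hVm.pow_const _)
    rw [lintegral_const_mul _ hVam]
    calc _ ≤ _ := mul_le_mul_left (ENNReal.rpow_le_rpow h1 hp0.le) _
      _ = _ := by
        have e1 : 1 / (p / (p - 1)) * p = p - 1 := by
          have : p - 1 ≠ 0 := by linarith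
          field_simp
        have e2 : -a - 1 = a * (p - 1) + -p := by rw [ha]; field_simp; ring
        have hp1 : 0 ≤ p - 1 := by linarith
        rw [ENNReal.mul_rpow_of_nonneg _ _ hp0.le, ← ENNReal.rpow_mul, ← ENNReal.rpow_mul,
          one_div_mul_cancel hp0.ne', ENNReal.rpow_one, e1, ENNReal.mul_rpow_of_nonneg _ _ hp1,
          ← ENNReal.rpow_mul, e2, ENNReal.rpow_add _ _ h0 ht, ENNReal.inv_rpow,
          ← ENNReal.rpow_neg]
        ring
  calc _ ≤ ∫⁻ s, ENNReal.ofReal a ^ (-(p - 1)) *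
        ∫⁻ t in Ioi s, ν (Ioi s) ^ (-a - 1) * (m t ^ p * ν (Ioi t) ^ a) ∂ν ∂ν := by
        refine lintegral_mono_ae ?_
        filter_upwards [hν.ae_pos] with s hs using hpoint s hs
    _ = ENNReal.ofReal a ^ (-(p - 1)) *
        ∫⁻ t, (m t ^ p * ν (Ioi t) ^ a) * ∫⁻ s in Iio t, ν (Ioi s) ^ (-a - 1) ∂ν ∂ν := by
        rw [lintegral_const_mul']
        · have hk : Measurable (Function.uncurry fun s t =>
              ν (Ioi s) ^ (-a - 1) * (m t ^ p * ν (Ioi t) ^ a)) :=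
            ((hVm.comp measurable_fst).pow_const _).mul
              (((hm.comp measurable_snd).pow_const _).mul ((hVm.comp measurable_snd).pow_const _))
          rw [lintegral_lintegral_Ioi_swap hk]
          congr 2
          ext t
          rw [lintegral_mul_const _ (hVm.pow_const _), mul_comm]
        · exact ENNReal.rpow_ne_top_of_ne_zero hA0 hAt
    _ ≤ ENNReal.ofReal a ^ (-(p - 1)) * ∫⁻ t, (ENNReal.ofReal a)⁻¹ * m t ^ p ∂ν := by
        refine mul_le_mul_right (lintegral_mono_ae ?_) _
        filter_upwards [hν.ae_pos] with t ht
        have h3 : ∫⁻ s in Iio t, ν (Ioi s) ^ (-a - 1) ∂ν ≤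
            (ENNReal.ofReal a)⁻¹ * ν (Ioi t) ^ (-a) := by
          have e : ∫⁻ s in Iio t, ν (Ioi s) ^ (-a - 1) ∂ν =
              ∫⁻ s in Ioo 0 t, ν (Ioi s) ^ (-a - 1) ∂ν := by
            refine setLIntegral_congr ?_
            filter_upwards [hν.ae_pos] with x hx
            exact propext ⟨fun h => ⟨hx, h⟩, fun h => h.2⟩
          rw [e]
          calc _ = (ENNReal.ofReal a)⁻¹ * (ENNReal.ofReal a *
                ∫⁻ s in Ioo 0 t, ν (Ioi s) ^ (-a - 1) ∂ν) := by
                rw [← mul_assoc, ENNReal.inv_mul_cancel hA0 hAt, one_mul]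
            _ ≤ _ := by
                gcongr
                exact mul_setLIntegral_Ioo_rpow_neg_le ν ha0 (hν.Ioi_ne_zero t) hV
        calc _ ≤ _ := mul_le_mul_right h3 _
          _ = (ENNReal.ofReal a)⁻¹ * (m t ^ p * (ν (Ioi t) ^ a * ν (Ioi t) ^ (-a))) := by ring
          _ = _ := by
            rw [← ENNReal.rpow_add _ _ (hν.Ioi_ne_zero t) (hV t ht), add_neg_cancel,
              ENNReal.rpow_zero, mul_one]
    _ = _ := by
        rw [lintegral_const_mul _ (hm.pow_const _), ← mul_assoc, ← ENNReal.rpow_neg_one,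
          ← ENNReal.rpow_add _ _ hA0 hAt]
        congr 2
        ring

/-- A Minkowski-type inequality for tails of a measure. -/
theorem setLIntegral_tail_rpow_le [SFinite μ] [NullSingletonClass μ] [SFinite ν]
    {k x : ℝ} (hk : 1 ≤ k) (hU0 : ∀ t, x < t → μ (Ioc x t) ≠ 0)
    (hUt : ∀ t, x < t → μ (Ioc x t) ≠ ∞) :
    (∫⁻ t in Ioi x, ν (Ioi t) ^ k ∂μ) ^ (1 / k) ≤
      ENNReal.ofReal k * ∫⁻ s in Ioi x, μ (Ioc x s) ^ (1 / k) ∂ν := by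
  have hk0 : 0 < k := by linarith
  set Q := ∫⁻ s in Ioi x, μ (Ioc x s) ^ (1 / k) ∂ν with hQ
  rcases eq_or_ne Q ∞ with hQt | hQt
  · rw [hQt, ENNReal.mul_top (by simpa using hk0)]
    exact le_top
  have hUm : Measurable fun t => μ (Ioc x t) :=
    (measurable_measure_Ioc μ).comp measurable_prodMk_left
  have hle : ∀ t, x < t → ν (Ioi t) * μ (Ioc x t) ^ (1 / k) ≤ Q := fun t ht => by
    rw [mul_comm, ← setLIntegral_const]
    exact (setLIntegral_mono' measurableSet_Ioi fun s hs => ENNReal.rpow_le_rpow (measure_mono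
      (Ioc_subset_Ioc_right (le_of_lt hs))) (by positivity)).trans
        (lintegral_mono_set (Ioi_subset_Ioi ht.le))
  have hpt : ∀ t ∈ Ioi x, ν (Ioi t) ^ k ≤
      Q ^ (k - 1) * (∫⁻ s in Ioi t, μ (Ioc x t) ^ (1 / k - 1) ∂ν) := fun t ht => by
    have h0 := hU0 t ht
    have htt := hUt t ht
    have hgQ : ν (Ioi t) ≤ Q * μ (Ioc x t) ^ (-(1 / k)) := by
      calc ν (Ioi t) = ν (Ioi t) * μ (Ioc x t) ^ (1 / k) * μ (Ioc x t) ^ (-(1 / k)) := by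
            rw [mul_assoc, ← ENNReal.rpow_add _ _ h0 htt, add_neg_cancel, ENNReal.rpow_zero,
              mul_one]
        _ ≤ _ := mul_le_mul_left (hle t ht) _
    rw [setLIntegral_const]
    calc ν (Ioi t) ^ k = ν (Ioi t) ^ (k - 1) * ν (Ioi t) := by
          nth_rewrite 3 [← ENNReal.rpow_one (ν (Ioi t))]
          rw [← ENNReal.rpow_add_of_nonneg _ _ (by linarith) zero_le_one, sub_add_cancel]
      _ ≤ (Q * μ (Ioc x t) ^ (-(1 / k))) ^ (k - 1) * ν (Ioi t) := by
          gcongr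
      _ = _ := by
          rw [ENNReal.mul_rpow_of_nonneg _ _ (by linarith), ← ENNReal.rpow_mul, mul_assoc]
          congr 3
          field_simp
          ring
  have hmain : ∫⁻ t in Ioi x, ν (Ioi t) ^ k ∂μ ≤ ENNReal.ofReal k * Q ^ k := by
    calc _ ≤ ∫⁻ t in Ioi x, Q ^ (k - 1) * (∫⁻ s in Ioi t, μ (Ioc x t) ^ (1 / k - 1) ∂ν) ∂μ :=
          setLIntegral_mono' measurableSet_Ioi hpt
      _ = Q ^ (k - 1) *
          ∫⁻ s, ∫⁻ t in Iio s, μ (Ioc x t) ^ (1 / k - 1) ∂(μ.restrict (Ioi x)) ∂ν := by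
          rw [lintegral_const_mul', lintegral_lintegral_Ioi_swap]
          · exact (hUm.comp measurable_fst).pow_const _
          · exact (ENNReal.rpow_lt_top_of_nonneg (by linarith) hQt).ne
      _ = Q ^ (k - 1) * ∫⁻ s in Ioi x, ENNReal.ofReal k * μ (Ioc x s) ^ (1 / k) ∂ν := by
          rw [← lintegral_indicator measurableSet_Ioi]
          congr 2
          ext s
          rw [setLIntegral_congr Iio_ae_eq_Iic]
          rcases le_or_gt s x with h | h
          · rw [indicator_of_notMem (by simpa using h), Measure.restrict_restrict measurableSet_Iic,
              show Iic s ∩ Ioi x = ∅ by ext y; simp only [mem_inter_iff, mem_Iic, mem_Ioi,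
                mem_empty_iff_false, iff_false, not_and]; intro h'; linarith]
            simp
          · have hr : ∀ y, μ.restrict (Ioi x) (Iic y) = μ (Ioc x y) := fun y => by
              rw [Measure.restrict_apply measurableSet_Iic, inter_comm, Ioi_inter_Iic]
            have := mul_setLIntegral_Iic_rpow (μ.restrict (Ioi x)) (t := s) (γ := 1 / k)
              (by positivity) (by rw [hr]; exact hUt s h)
            simp only [hr] at this
            rw [indicator_of_mem (by exact h), ← this, ← mul_assoc,
              ← ENNReal.ofReal_mul hk0.le, mul_one_div_cancel hk0.ne', ENNReal.ofReal_one, one_mul]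
      _ = _ := by
          rw [lintegral_const_mul _ (hUm.pow_const _), ← hQ]
          nth_rewrite 2 [← ENNReal.rpow_one Q]
          rw [mul_left_comm, ← ENNReal.rpow_add_of_nonneg _ _ (by linarith) zero_le_one,
            sub_add_cancel]
  calc _ ≤ (ENNReal.ofReal k * Q ^ k) ^ (1 / k) := by gcongr
    _ = ENNReal.ofReal k ^ (1 / k) * Q := by
        rw [ENNReal.mul_rpow_of_nonneg _ _ (by positivity), ← ENNReal.rpow_mul,
          mul_one_div_cancel hk0.ne', ENNReal.rpow_one]
    _ ≤ ENNReal.ofReal k * Q := by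
        gcongr
        exact (ENNReal.rpow_le_rpow_of_exponent_le (ENNReal.one_le_ofReal.2 hk)
          ((div_le_one hk0).2 hk)).trans_eq (ENNReal.rpow_one _)

end Hardy

section Sufficiency

variable {ω μ ν : Measure ℝ} {p q r : ℝ}

theorem measurable_setLIntegral_Ioi (ν : Measure ℝ) (m : ℝ → ℝ≥0∞) :
    Measurable fun t => ∫⁻ s in Ioi t, m s ∂ν :=
  Antitone.measurable fun _ _ h => lintegral_mono_set (Ioi_subset_Ioi h)

theorem setLIntegral_tail_ne_top (hp : 1 < p) (hV : ∀ x, 0 < x → ν (Ioi x) ≠ ∞)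
    {m : ℝ → ℝ≥0∞} (hm : Measurable m) (hX : ∫⁻ t, m t ^ p ∂ν ≠ ∞) {x : ℝ} (hx : 0 < x) :
    ∫⁻ t in Ioi x, m t ∂ν ≠ ∞ := by
  have hpq : p.HolderConjugate (p / (p - 1)) := Real.HolderConjugate.conjExponent hp
  have := ENNReal.lintegral_mul_le_Lp_mul_Lq (ν.restrict (Ioi x)) hpq hm.aemeasurable
    (g := 1) measurable_const.aemeasurable
  rw [mul_one] at this
  refine ne_top_of_le_ne_top ?_ this
  refine ENNReal.mul_ne_top (ENNReal.rpow_ne_top_of_nonneg (by simp; linarith)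
    (ne_top_of_le_ne_top hX (setLIntegral_le_lintegral _ _)))
      (ENNReal.rpow_ne_top_of_nonneg hpq.symm.one_div_nonneg ?_)
  simpa using hV x hx

theorem tail_kernel_rpow_le [SFinite μ] [NullSingletonClass μ] [SFinite ν] [NullSingletonClass ν]
    (hμ : IsPositiveOnIoi μ) (hp : 1 < p) (hpr : p ≤ r)
    (hU : ∀ s y, 0 < s → μ (Ioc s y) ≠ ∞) {m : ℝ → ℝ≥0∞} (hm : Measurable m)
    (hH : ∀ x, 0 < x → ∫⁻ t in Ioi x, m t ∂ν ≠ ∞) {x : ℝ} (hx : 0 < x) :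
    (∫⁻ t in Ioi x, (∫⁻ s in Ioi t, m s ∂ν) ^ r ∂μ) ^ (p / r) ≤
      ENNReal.ofReal (r / p) * ENNReal.ofReal p * ∫⁻ s in Ioi x,
        (∫⁻ τ in Ioi s, m τ ∂ν) ^ (p - 1) * m s * μ (Ioc x s) ^ (p / r) ∂ν := by
  have hp0 : 0 < p := by linarith
  have hr0 : 0 < r := by linarith
  set H : ℝ → ℝ≥0∞ := fun t => ∫⁻ s in Ioi t, m s ∂ν with hHdef
  have hνm : ∀ t, ν.withDensity m (Ioi t) = H t := fun t => withDensity_apply _ measurableSet_Ioi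
  have hHm : Measurable H := measurable_setLIntegral_Ioi ν m
  set d : ℝ → ℝ≥0∞ := fun s => ENNReal.ofReal p * (H s ^ (p - 1) * m s) with hd
  have hdm : Measurable d := ((hHm.pow_const _).mul hm).const_mul _
  have hη : ∀ t, 0 < t → ν.withDensity d (Ioi t) = H t ^ p := fun t ht => by
    have := mul_setLIntegral_Ioi_rpow (ν.withDensity m) hp0 (t := t) (by rw [hνm]; exact hH t ht)
    simp only [hνm] at this
    rw [setLIntegral_withDensity_eq_setLIntegral_mul _ hm (hHm.pow_const _)
      measurableSet_Ioi] at this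
    rw [← this, withDensity_apply _ measurableSet_Ioi,
      ← lintegral_const_mul _ (hm.mul (hHm.pow_const _))]
    simp only [Pi.mul_apply, hd, mul_comm (m _)]
  have key := setLIntegral_tail_rpow_le (μ := μ) (ν := ν.withDensity d) (k := r / p) (x := x)
    ((one_le_div hp0).2 hpr) (fun t ht => hμ.Ioc_ne_zero hx.le ht) (fun t _ => hU x t hx)
  have hUm : Measurable fun t => μ (Ioc x t) ^ (p / r) :=
    ((measurable_measure_Ioc μ).comp measurable_prodMk_left).pow_const _
  rw [one_div_div, setLIntegral_withDensity_eq_setLIntegral_mul _ hdm hUm measurableSet_Ioi] at key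
  refine le_trans (le_of_eq ?_) (key.trans (le_of_eq ?_))
  · congr 1
    refine setLIntegral_congr_fun measurableSet_Ioi fun t ht => ?_
    rw [hη t (hx.trans ht), ← ENNReal.rpow_mul, mul_div_cancel₀ _ hp0.ne']
  · rw [mul_assoc (ENNReal.ofReal (r / p)),
      ← lintegral_const_mul' (ENNReal.ofReal p) _ ofReal_ne_top]
    simp only [Pi.mul_apply, hd, H, mul_assoc]

theorem lintegral_rpow_sub_one_mul_le [SFinite ν] [NullSingletonClass ν] (hν : IsPositiveOnIoi ν)
    (hV : ∀ x, 0 < x → ν (Ioi x) ≠ ∞) (hp : 1 < p) {m : ℝ → ℝ≥0∞} (hm : Measurable m) :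
    ∫⁻ s, (∫⁻ τ in Ioi s, m τ ∂ν) ^ (p - 1) * m s * ν (Ioi s) ^ (-(p - 1)) ∂ν ≤
      (ENNReal.ofReal ((p - 1) / p) ^ (-p)) ^ ((p - 1) / p) * ∫⁻ t, m t ^ p ∂ν := by
  have hp0 : 0 < p := by linarith
  have hp1 : 0 < p - 1 := by linarith
  have hpq : p.HolderConjugate (p / (p - 1)) := Real.HolderConjugate.conjExponent hp
  set H : ℝ → ℝ≥0∞ := fun t => ∫⁻ s in Ioi t, m s ∂ν with hHdef
  have hHm : Measurable H := measurable_setLIntegral_Ioi ν m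
  have hH := lintegral_tail_rpow_mul_le hν hV hp hm
  have := ENNReal.lintegral_mul_le_Lp_mul_Lq ν hpq hm.aemeasurable
    (g := fun s => H s ^ (p - 1) * ν (Ioi s) ^ (-(p - 1)))
    ((hHm.pow_const _).mul ((measurable_measure_Ioi ν).pow_const _)).aemeasurable
  have e : ∀ s, (H s ^ (p - 1) * ν (Ioi s) ^ (-(p - 1))) ^ (p / (p - 1)) =
      H s ^ p * ν (Ioi s) ^ (-p) := fun s => by
    rw [ENNReal.mul_rpow_of_nonneg _ _ (by positivity), ← ENNReal.rpow_mul, ← ENNReal.rpow_mul]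
    congr 2 <;> field_simp
  simp only [e, Pi.mul_apply] at this
  have e2 : 1 / (p / (p - 1)) = (p - 1) / p := one_div_div _ _
  have hpp : 0 ≤ (p - 1) / p := by positivity
  calc _ = ∫⁻ s, m s * (H s ^ (p - 1) * ν (Ioi s) ^ (-(p - 1))) ∂ν :=
        lintegral_congr fun s => by ring
    _ ≤ _ := this
    _ ≤ (∫⁻ t, m t ^ p ∂ν) ^ (1 / p) *
        (ENNReal.ofReal ((p - 1) / p) ^ (-p) * ∫⁻ t, m t ^ p ∂ν) ^ ((p - 1) / p) := by
        rw [e2]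
        gcongr
    _ = _ := by
        rw [ENNReal.mul_rpow_of_nonneg _ _ hpp, mul_left_comm,
          ← ENNReal.rpow_add_of_nonneg _ _ (by positivity) hpp,
          show 1 / p + (p - 1) / p = 1 by field_simp; ring, ENNReal.rpow_one]

/-- The constant in the weighted inequality for tails. -/
def tailConstant (p r : ℝ) : ℝ≥0∞ :=
  ENNReal.ofReal (r / p) * ENNReal.ofReal p *
    (ENNReal.ofReal ((p - 1) / p) ^ (-p)) ^ ((p - 1) / p)

theorem tailConstant_ne_zero (hp : 1 < p) (hr : 0 < r) : tailConstant p r ≠ 0 := by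
  have h1 : 0 < r / p := by positivity
  have h2 : 0 < p := by linarith
  have h3 : ENNReal.ofReal ((p - 1) / p) ^ (-p) ≠ 0 := by
    simp [ENNReal.rpow_eq_zero_iff, h2, h2.not_gt]
  have h4 : ¬ (p - 1) / p < 0 := not_lt.2 (div_nonneg (by linarith) h2.le)
  simp [tailConstant, h1, h2, ENNReal.rpow_eq_zero_iff, h3, h4]

theorem tailConstant_ne_top (hp : 1 < p) : tailConstant p r ≠ ∞ := by
  have h2 : 0 < (p - 1) / p := div_pos (by linarith) (by linarith)
  refine ENNReal.mul_ne_top (ENNReal.mul_ne_top ofReal_ne_top ofReal_ne_top)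
    (ENNReal.rpow_ne_top_of_nonneg h2.le (ENNReal.rpow_ne_top_of_ne_zero ?_ ofReal_ne_top))
  simpa using h2

theorem lintegral_tail_kernel_rpow_mul_le [SFinite ω] [NullSingletonClass ω] [SFinite μ]
    [NullSingletonClass μ] [SFinite ν] [NullSingletonClass ν] (hω : IsPositiveOnIoi ω)
    (hμ : IsPositiveOnIoi μ) (hν : IsPositiveOnIoi ν) (hp : 1 < p) (hpr : p ≤ r)
    (hU : ∀ s y, 0 < s → μ (Ioc s y) ≠ ∞) (hV : ∀ x, 0 < x → ν (Ioi x) ≠ ∞)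
    {g : ℝ → ℝ≥0∞} (hg : Measurable g)
    (hK : ∀ y, 0 < y → ∫⁻ s in Iio y, μ (Ioc s y) ^ (p / r) * g s ∂ω ≤ ν (Ioi y) ^ (-(p - 1)))
    {m : ℝ → ℝ≥0∞} (hm : Measurable m) :
    ∫⁻ x, (∫⁻ t in Ioi x, (∫⁻ s in Ioi t, m s ∂ν) ^ r ∂μ) ^ (p / r) * g x ∂ω ≤
      tailConstant p r * ∫⁻ t, m t ^ p ∂ν := by
  have hr0 : 0 < r := by linarith
  by_cases hX : ∫⁻ t, m t ^ p ∂ν = ∞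
  · rw [hX, ENNReal.mul_top (tailConstant_ne_zero hp hr0)]
    exact le_top
  have hH := fun x hx => setLIntegral_tail_ne_top hp hV hm hX (x := x) hx
  have hHm := measurable_setLIntegral_Ioi ν m
  have hUm := (measurable_measure_Ioc μ).pow_const (p / r)
  have hk : Measurable (Function.uncurry fun x s => (∫⁻ τ in Ioi s, m τ ∂ν) ^ (p - 1) * m s *
      (μ (Ioc x s) ^ (p / r) * g x)) :=
    (((hHm.comp measurable_snd).pow_const _).mul (hm.comp measurable_snd)).mul
      (hUm.mul (hg.comp measurable_fst))
  calc _ ≤ ∫⁻ x, ENNReal.ofReal (r / p) * ENNReal.ofReal p * ∫⁻ s in Ioi x,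
        (∫⁻ τ in Ioi s, m τ ∂ν) ^ (p - 1) * m s * (μ (Ioc x s) ^ (p / r) * g x) ∂ν ∂ω := by
        refine lintegral_mono_ae ?_
        filter_upwards [hω.ae_pos] with x hx
        refine (mul_le_mul_left (tail_kernel_rpow_le hμ hp hpr hU hm hH hx) _).trans_eq ?_
        rw [mul_assoc, ← lintegral_mul_const]
        · simp only [mul_assoc]
        · exact ((hHm.pow_const _).mul hm).mul (hUm.comp measurable_prodMk_left)
    _ = ENNReal.ofReal (r / p) * ENNReal.ofReal p * ∫⁻ s, (∫⁻ τ in Ioi s, m τ ∂ν) ^ (p - 1) *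
        m s * ∫⁻ x in Iio s, μ (Ioc x s) ^ (p / r) * g x ∂ω ∂ν := by
        rw [lintegral_const_mul' _ _ (ENNReal.mul_ne_top ofReal_ne_top ofReal_ne_top),
          lintegral_lintegral_Ioi_swap hk]
        congr 2
        ext s
        rw [lintegral_const_mul]
        exact (hUm.comp measurable_prodMk_right).mul hg
    _ ≤ ENNReal.ofReal (r / p) * ENNReal.ofReal p * ∫⁻ s, (∫⁻ τ in Ioi s, m τ ∂ν) ^ (p - 1) *
        m s * ν (Ioi s) ^ (-(p - 1)) ∂ν := by
        refine mul_le_mul_right (lintegral_mono_ae ?_) _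
        filter_upwards [hν.ae_pos] with s hs
        exact mul_le_mul_right (hK s hs) _
    _ ≤ _ := by
        rw [tailConstant, mul_assoc _ _ (∫⁻ t, m t ^ p ∂ν)]
        exact mul_le_mul_right (lintegral_rpow_sub_one_mul_le hν hV hp hm) _

end Sufficiency

section SufficiencyConclusion

variable {ω μ ν : Measure ℝ} {p q r α θ : ℝ} {φ : ℝ → ℝ≥0∞}

theorem rpow_measure_Ioc_ne_zero (hμ : IsPositiveOnIoi μ) (hα : 0 ≤ α) {s y : ℝ} (hs : 0 ≤ s)
    (hsy : s < y) : μ (Ioc s y) ^ α ≠ 0 := by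
  simp [ENNReal.rpow_eq_zero_iff, hμ.Ioc_ne_zero hs hsy, hα.not_gt]

theorem kernelSup_ne_zero (hμ : IsPositiveOnIoi μ) (hα : 0 ≤ α) (hφ : ∀ y, 0 < y → φ y ≠ 0)
    {t : ℝ} (ht : 0 < t) : kernelSup μ α φ t ≠ 0 := by
  refine ne_of_gt (lt_of_lt_of_le (pos_iff_ne_zero.2 (mul_ne_zero ?_ ?_))
    (le_kernelSup (lt_add_one t)))
  · exact rpow_measure_Ioc_ne_zero hμ hα ht.le (lt_add_one t)
  · exact hφ _ (by linarith)

section Finiteness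

variable (hω : IsPositiveOnIoi ω) (hμ : IsPositiveOnIoi μ) (hα : 0 < α) (hθ : 0 < θ)
  (hφ : ∀ y, 0 < y → φ y ≠ 0) (hfin : ∫⁻ t, sufficiencyDensity ω μ α θ φ t ∂ω ≠ ∞)

include hω hα hθ hfin in
theorem exists_sufficiencyDensity_ne_top {a b : ℝ} (ha : 0 ≤ a) (hab : a < b) :
    ∃ t ∈ Ioc a b, sufficiencyDensity ω μ α θ φ t ≠ ∞ := by
  by_contra! h
  have := ae_lt_top (measurable_sufficiencyDensity hα.le hθ.le) hfin
  refine hω.Ioc_ne_zero ha hab (measure_mono_null ?_ (ae_iff.1 this))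
  intro t ht
  simp [h t ht]

include hω hμ hα hθ hφ hfin

theorem kernelPrimitive_ne_top_of_sufficiencyDensity (t : ℝ) : kernelPrimitive ω μ α t ≠ ∞ := by
  intro h
  obtain ⟨s, hs, hs'⟩ := exists_sufficiencyDensity_ne_top hω hα hθ hfin
    (le_max_right t 0) (lt_add_one (max t 0))
  have hs0 : 0 < s := (le_max_right t 0).trans_lt hs.1
  have hW : kernelPrimitive ω μ α s = ∞ := eq_top_mono
    (kernelPrimitive_mono hα.le ((le_max_left t 0).trans hs.1.le)) h
  apply hs'
  rw [sufficiencyDensity, hW, ENNReal.top_rpow_of_pos hθ, ENNReal.top_mul, top_add]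
  exact kernelSup_ne_zero hμ hα.le hφ hs0

omit hμ in
theorem measure_Ioc_ne_top_of_sufficiencyDensity (s y : ℝ) (hs : 0 < s) : μ (Ioc s y) ≠ ∞ := by
  intro h
  rcases le_or_gt y s with hsy | hsy
  · simp [Ioc_eq_empty (not_lt.2 hsy)] at h
  obtain ⟨t, ht, ht'⟩ := exists_sufficiencyDensity_ne_top hω hα hθ hfin le_rfl hs
  have hW : μ (Ioc t y) = ∞ := eq_top_mono (measure_mono (Ioc_subset_Ioc_left ht.2)) h
  have hty : t < y := ht.2.trans_lt hsy
  have hα' : 0 < α * (1 + θ) := by positivity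
  have hsup : kernelSup μ (α * (1 + θ)) φ t = ∞ := by
    refine eq_top_mono (le_kernelSup hty) ?_
    rw [hW, ENNReal.top_rpow_of_pos hα', ENNReal.top_mul (hφ y (ht.1.trans hty))]
  apply ht'
  rw [sufficiencyDensity, hsup, ENNReal.mul_top, add_top]
  simp [ENNReal.rpow_eq_zero_iff, hω.Iic_ne_zero ht.1, hθ.not_gt]

end Finiteness

theorem exists_tail_inequality_of_sufficiencyDensity [SFinite ω] [NullSingletonClass ω] [SFinite μ]
    [NullSingletonClass μ] [SFinite ν] [NullSingletonClass ν] (hω : IsPositiveOnIoi ω)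
    (hμ : IsPositiveOnIoi μ) (hν : IsPositiveOnIoi ν) (hq : 0 < q) (hp : 1 < p) (hqp : q < p)
    (hpr : p ≤ r) (hV : ∀ x, 0 < x → ν (Ioi x) ≠ ∞)
    (hfin : ∫⁻ t, sufficiencyDensity ω μ (q / r) (q / (p - q))
      (fun y => ν (Ioi y) ^ ((p - 1) * q / (p - q))) t ∂ω ≠ ∞) :
    ∃ C : ℝ≥0∞, C ≠ ∞ ∧ ∀ m : ℝ → ℝ≥0∞, Measurable m →
      ∫⁻ x, (∫⁻ t in Ioi x, (∫⁻ s in Ioi t, m s ∂ν) ^ r ∂μ) ^ (q / r) ∂ω ≤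
        C * (∫⁻ t, m t ^ p ∂ν) ^ (q / p) := by
  have hp0 : 0 < p := by linarith
  have hr0 : 0 < r := by linarith
  have hpq : 0 < p - q := by linarith
  have hα : 0 < q / r := by positivity
  have hα1 : q / r ≤ 1 := (div_le_one hr0).2 (by linarith)
  have hθ : 0 < q / (p - q) := by positivity
  have hκ : 0 ≤ (p - 1) * q / (p - q) := by
    have : 0 < p - 1 := by linarith
    positivity
  have hφ : ∀ y, 0 < y → ν (Ioi y) ^ ((p - 1) * q / (p - q)) ≠ 0 := fun y _ => by
    simp [ENNReal.rpow_eq_zero_iff, hν.Ioi_ne_zero y, hκ.not_gt]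
  set φ : ℝ → ℝ≥0∞ := fun y => ν (Ioi y) ^ ((p - 1) * q / (p - q)) with hφdef
  set α := q / r with hαdef
  set θ := q / (p - q) with hθdef
  have hS := kernelPrimitive_ne_top_of_sufficiencyDensity hω hμ hα hθ hφ hfin
  have hU := measure_Ioc_ne_top_of_sufficiencyDensity hω hα hθ hφ hfin
  have hS0 : ∀ t, 0 < t → kernelPrimitive ω μ α t ^ θ ≠ 0 := fun t ht => by
    simp [ENNReal.rpow_eq_zero_iff, kernelPrimitive_ne_zero hω hμ hα ht, hθ.not_gt]
  set N := kernelSup μ α (fun y => kernelPrimitive ω μ α y ^ θ * φ y) with hN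
  have hNm : Measurable N := measurable_kernelSup hα.le
  have hNfin : ∫⁻ t, N t ∂ω ≠ ∞ := by
    refine ne_top_of_le_ne_top (ENNReal.mul_ne_top (ENNReal.mul_ne_top ?_ ?_) hfin)
      (lintegral_kernelSup_kernelPrimitive_le hω hμ hα hα1 hθ hS)
    · exact ENNReal.rpow_ne_top_of_nonneg hθ.le (by simp)
    · exact ENNReal.add_ne_top.2 ⟨by simp, ENNReal.mul_ne_top (by simp) ofReal_ne_top⟩
  have hN0 : ∀ t, 0 < t → N t ≠ 0 := fun t ht =>
    kernelSup_ne_zero hμ hα.le (fun y hy => mul_ne_zero (hS0 y hy) (hφ y hy)) ht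
  set g : ℝ → ℝ≥0∞ := fun s => N s ^ (-(1 / θ)) with hg
  have hK : ∀ y, 0 < y → ∫⁻ s in Iio y, μ (Ioc s y) ^ (p / r) * g s ∂ω ≤
      ν (Ioi y) ^ (-(p - 1)) := by
    intro y hy
    have hpt : ∀ s, 0 < s → s < y → μ (Ioc s y) ^ (p / r) * g s ≤
        μ (Ioc s y) ^ α * ((kernelPrimitive ω μ α y)⁻¹ * ν (Ioi y) ^ (-(p - 1))) := by
      intro s hs hsy
      have hU0 := hμ.Ioc_ne_zero hs.le hsy
      have hUt := hU s y hs
      have hle : μ (Ioc s y) ^ α * (kernelPrimitive ω μ α y ^ θ * φ y) ≤ N s :=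
        le_kernelSup (φ := fun y => kernelPrimitive ω μ α y ^ θ * φ y) hsy
      have h1 : μ (Ioc s y) ^ ((p - q) / r) * (kernelPrimitive ω μ α y * ν (Ioi y) ^ (p - 1)) ≤
          N s ^ (1 / θ) := by
        refine le_trans (le_of_eq ?_) (ENNReal.rpow_le_rpow hle (by positivity))
        rw [ENNReal.mul_rpow_of_nonneg _ _ (by positivity),
          ENNReal.mul_rpow_of_nonneg _ _ (by positivity), ← ENNReal.rpow_mul, ← ENNReal.rpow_mul,
          ← ENNReal.rpow_mul, mul_one_div_cancel hθ.ne', ENNReal.rpow_one]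
        congr 2
        · rw [hαdef, hθdef]; field_simp
        · congr 1; rw [hθdef]; field_simp
      have h2 : g s ≤ μ (Ioc s y) ^ (-((p - q) / r)) *
          ((kernelPrimitive ω μ α y)⁻¹ * ν (Ioi y) ^ (-(p - 1))) := by
        rw [hg]
        beta_reduce
        rw [ENNReal.rpow_neg, ENNReal.rpow_neg, ENNReal.rpow_neg, ← ENNReal.mul_inv,
          ← ENNReal.mul_inv]
        · exact ENNReal.inv_le_inv.2 h1
        · exact Or.inl (rpow_measure_Ioc_ne_zero hμ (by positivity) hs.le hsy)
        · exact Or.inl (ENNReal.rpow_ne_top_of_nonneg (by positivity) hUt)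
        · exact Or.inl (kernelPrimitive_ne_zero hω hμ hα hy)
        · exact Or.inl (hS y)
      calc _ ≤ μ (Ioc s y) ^ (p / r) * (μ (Ioc s y) ^ (-((p - q) / r)) *
          ((kernelPrimitive ω μ α y)⁻¹ * ν (Ioi y) ^ (-(p - 1)))) := mul_le_mul_right h2 _
        _ = _ := by
          rw [← mul_assoc, ← ENNReal.rpow_add _ _ hU0 hUt]
          congr 2
          rw [hαdef]; ring
    calc _ ≤ ∫⁻ s in Iio y, μ (Ioc s y) ^ α *
          ((kernelPrimitive ω μ α y)⁻¹ * ν (Ioi y) ^ (-(p - 1))) ∂ω := by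
          refine lintegral_mono_ae ?_
          filter_upwards [ae_restrict_of_ae hω.ae_pos, ae_restrict_mem measurableSet_Iio]
            with s hs hsy using hpt s hs hsy
      _ = kernelPrimitive ω μ α y * ((kernelPrimitive ω μ α y)⁻¹ * ν (Ioi y) ^ (-(p - 1))) := by
          rw [setLIntegral_congr Iio_ae_eq_Iic, lintegral_mul_const]
          · rfl
          · exact ((measurable_measure_Ioc μ).comp measurable_prodMk_right).pow_const α
      _ ≤ _ := by
          rw [← mul_assoc]
          exact (mul_le_mul_left (ENNReal.mul_inv_le_one _) _).trans_eq (one_mul _)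
  refine ⟨tailConstant p r ^ (q / p) * (∫⁻ t, N t ∂ω) ^ ((p - q) / p),
    ENNReal.mul_ne_top (ENNReal.rpow_ne_top_of_nonneg (by positivity) (tailConstant_ne_top hp))
      (ENNReal.rpow_ne_top_of_nonneg (by positivity) hNfin), fun m hm => ?_⟩
  have hFm : Measurable fun x => ∫⁻ t in Ioi x, (∫⁻ s in Ioi t, m s ∂ν) ^ r ∂μ :=
    measurable_setLIntegral_Ioi _ _
  have hmain := lintegral_tail_kernel_rpow_mul_le hω hμ hν hp hpr hU hV (hNm.pow_const _) hK hm
  set F : ℝ → ℝ≥0∞ := fun x => ∫⁻ t in Ioi x, (∫⁻ s in Ioi t, m s ∂ν) ^ r ∂μ with hF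
  have hconj : (p / q).HolderConjugate (p / (p - q)) := by
    rw [Real.holderConjugate_iff]
    refine ⟨(one_lt_div hq).2 hqp, ?_⟩
    field_simp
    ring
  have hhol := ENNReal.lintegral_mul_le_Lp_mul_Lq ω hconj
    (f := fun x => (F x ^ (p / r) * g x) ^ (q / p)) (g := fun x => N x ^ ((p - q) / p))
    (((hFm.pow_const _).mul (hNm.pow_const _)).pow_const _).aemeasurable
    (hNm.pow_const _).aemeasurable
  have e1 : ∀ a : ℝ≥0∞, (a ^ (q / p)) ^ (p / q) = a := fun a => by
    rw [← ENNReal.rpow_mul, show q / p * (p / q) = 1 by field_simp, ENNReal.rpow_one]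
  have e2 : ∀ a : ℝ≥0∞, (a ^ ((p - q) / p)) ^ (p / (p - q)) = a := fun a => by
    rw [← ENNReal.rpow_mul, show (p - q) / p * (p / (p - q)) = 1 by field_simp, ENNReal.rpow_one]
  simp only [e1, e2, one_div_div] at hhol
  calc ∫⁻ x, F x ^ α ∂ω
      = ∫⁻ x, (F x ^ (p / r) * g x) ^ (q / p) * N x ^ ((p - q) / p) ∂ω := by
        refine lintegral_congr_ae ?_
        filter_upwards [hω.ae_pos, ae_lt_top hNm hNfin] with x hx hxt
        rw [ENNReal.mul_rpow_of_nonneg _ _ (by positivity), hg, ← ENNReal.rpow_mul,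
          ← ENNReal.rpow_mul, mul_assoc, ← ENNReal.rpow_add _ _ (hN0 x hx) hxt.ne,
          show -(1 / θ) * (q / p) + (p - q) / p = 0 by rw [hθdef]; field_simp; ring,
          ENNReal.rpow_zero, mul_one, show p / r * (q / p) = α by rw [hαdef]; field_simp]
    _ ≤ _ := hhol
    _ ≤ (tailConstant p r * ∫⁻ t, m t ^ p ∂ν) ^ (q / p) * (∫⁻ t, N t ∂ω) ^ ((p - q) / p) := by
        gcongr
    _ = _ := by
        rw [ENNReal.mul_rpow_of_nonneg _ _ (by positivity)]
        ring

end SufficiencyConclusion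

section TailInequality

variable {ω μ ν : Measure ℝ} {p q r : ℝ} {D : ℝ≥0∞}

/-- The weighted inequality for iterated tails, in terms of the three underlying measures. -/
def TailInequality (ω μ ν : Measure ℝ) (p q r : ℝ) (D : ℝ≥0∞) : Prop :=
  ∀ m : ℝ → ℝ≥0∞, Measurable m →
    ∫⁻ x, (∫⁻ t in Ioi x, (∫⁻ s in Ioi t, m s ∂ν) ^ r ∂μ) ^ (q / r) ∂ω ≤
      D * (∫⁻ t, m t ^ p ∂ν) ^ (q / p)

theorem ENNReal.le_rpow_of_le_mul_rpow {X A : ℝ≥0∞} {a : ℝ} (ha : a < 1)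
    (hX : X ≠ ∞) (h : X ≤ A * X ^ a) : X ≤ A ^ (1 / (1 - a)) := by
  have h1 : 0 < 1 - a := by linarith
  rcases eq_or_ne X 0 with rfl | h0
  · exact zero_le
  have h2 : X ^ (1 - a) ≤ A := by
    rw [ENNReal.rpow_sub _ _ h0 hX, ENNReal.rpow_one]
    exact ENNReal.div_le_of_le_mul h
  calc X = (X ^ (1 - a)) ^ (1 / (1 - a)) := by
        rw [← ENNReal.rpow_mul, mul_one_div_cancel h1.ne', ENNReal.rpow_one]
    _ ≤ _ := by gcongr

theorem exists_measure_Iic_eq (ω : Measure ℝ) [NullSingletonClass ω] {c : ℝ≥0∞} {t : ℝ}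
    (hc : c ≠ 0) (hct : c ≤ ω (Iic t)) (ht : ω (Iic t) ≠ ∞) : ∃ s ≤ t, ω (Iic s) = c := by
  rcases hct.eq_or_lt with h | h
  · exact ⟨t, le_rfl, h.symm⟩
  have : IsFiniteMeasure (ω.restrict (Iic t)) := isFiniteMeasure_restrict.2 ht
  have hcT : c ≠ ∞ := h.ne_top
  obtain ⟨s, hs⟩ := exists_real_Iic_eq (ω.restrict (Iic t)) (c := c.toReal)
    (ENNReal.toReal_pos hc hcT) (by
      rw [measureReal_restrict_apply MeasurableSet.univ, univ_inter]
      exact (ENNReal.toReal_lt_toReal hcT ht).2 h)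
  rw [measureReal_restrict_apply measurableSet_Iic, Iic_inter_Iic] at hs
  refine ⟨min s t, min_le_right _ _, ?_⟩
  exact (ENNReal.toReal_eq_toReal_iff' (ne_top_of_le_ne_top ht (measure_mono
    (Iic_subset_Iic.2 (min_le_right _ _)))) hcT).1 hs

theorem rpow_tail_mul_rpow_le (hr : 0 < r) (hq : 0 ≤ q) {m : ℝ → ℝ≥0∞} {x y : ℝ} :
    (∫⁻ s in Ioi y, m s ∂ν) ^ q * μ (Ioc x y) ^ (q / r) ≤
      (∫⁻ t in Ioi x, (∫⁻ s in Ioi t, m s ∂ν) ^ r ∂μ) ^ (q / r) := by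
  have h : (∫⁻ s in Ioi y, m s ∂ν) ^ r * μ (Ioc x y) ≤
      ∫⁻ t in Ioi x, (∫⁻ s in Ioi t, m s ∂ν) ^ r ∂μ := by
    rw [← setLIntegral_const]
    exact (setLIntegral_mono' measurableSet_Ioc fun t ht => ENNReal.rpow_le_rpow
      (lintegral_mono_set (Ioi_subset_Ioi ht.2)) hr.le).trans
        (lintegral_mono_set Ioc_subset_Ioi_self)
  refine le_trans (le_of_eq ?_) (ENNReal.rpow_le_rpow h (by positivity : 0 ≤ q / r))
  rw [ENNReal.mul_rpow_of_nonneg _ _ (by positivity), ← ENNReal.rpow_mul,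
    mul_div_cancel₀ _ hr.ne']

namespace TailInequality

theorem measure_Iic_mul_le (h : TailInequality ω μ ν p q r D) (hp : 0 < p) (hq : 0 < q)
    (hr : 0 < r) (x y : ℝ) :
    ω (Iic x) * μ (Ioc x y) ^ (q / r) * ν (Ioi y) ^ q ≤ D * ν (Ioi y) ^ (q / p) := by
  have h1 := h ((Ioi y).indicator 1) (measurable_one.indicator measurableSet_Ioi)
  have e : ∫⁻ t, (Ioi y).indicator (1 : ℝ → ℝ≥0∞) t ^ p ∂ν = ν (Ioi y) := by
    rw [← lintegral_indicator_one measurableSet_Ioi]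
    congr 1
    ext t
    by_cases ht : t ∈ Ioi y <;> simp [ht, hp]
  rw [e] at h1
  refine le_trans ?_ h1
  calc _ = ∫⁻ _ in Iic x, ν (Ioi y) ^ q * μ (Ioc x y) ^ (q / r) ∂ω := by
        rw [setLIntegral_const]; ring
    _ ≤ ∫⁻ z in Iic x, (∫⁻ t in Ioi z, (∫⁻ s in Ioi t, (Ioi y).indicator 1 s ∂ν) ^ r ∂μ) ^
        (q / r) ∂ω := by
        refine setLIntegral_mono' measurableSet_Iic fun z hz => ?_
        refine le_trans ?_ (rpow_tail_mul_rpow_le hr hq.le (y := y))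
        rw [setLIntegral_congr_fun (g := 1) measurableSet_Ioi fun s hs => by
          rw [indicator_of_mem hs]]
        simp only [Pi.one_apply, setLIntegral_one]
        gcongr
        exact hz
    _ ≤ _ := setLIntegral_le_lintegral _ _

variable (h : TailInequality ω μ ν p q r D) (hD : D ≠ ∞) (hμ : IsPositiveOnIoi μ)
  (hν : IsPositiveOnIoi ν) (hV : ∀ x, 0 < x → ν (Ioi x) ≠ ∞) (hp : 1 < p) (hq : 0 < q)
  (hr : 0 < r) (hqp : q < p)

include h hD hμ hν hV hp hq hr in
theorem measure_Iic_ne_top (x : ℝ) : ω (Iic x) ≠ ∞ := by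
  intro hx
  have h0 : 0 ≤ max x 0 := le_max_right _ _
  have h1 := h.measure_Iic_mul_le (by linarith) hq hr (max x 0) (max x 0 + 1)
  have hVy := hV (max x 0 + 1) (by linarith)
  rw [eq_top_mono (measure_mono (Iic_subset_Iic.2 (le_max_left x 0))) hx,
    ENNReal.top_mul (rpow_measure_Ioc_ne_zero hμ (by positivity) h0 (lt_add_one _)),
    ENNReal.top_mul (by simp [ENNReal.rpow_eq_zero_iff, hν.Ioi_ne_zero, hq.not_gt]),
    top_le_iff] at h1
  exact ENNReal.mul_ne_top hD (ENNReal.rpow_ne_top_of_nonneg (by positivity) hVy) h1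

include h hD hν hV hp hq hr in
theorem measure_Ioc_ne_top {x : ℝ} (y : ℝ) (hx : ω (Iic x) ≠ 0) (hx0 : 0 ≤ x) :
    μ (Ioc x y) ≠ ∞ := by
  intro hxy
  rcases le_or_gt y x with hyx | hyx
  · simp [Ioc_eq_empty (not_lt.2 hyx)] at hxy
  have h1 := h.measure_Iic_mul_le (by linarith) hq hr x y
  have hVy := hV y (by linarith)
  rw [hxy, ENNReal.top_rpow_of_pos (by positivity), ENNReal.mul_top hx,
    ENNReal.top_mul (by simp [ENNReal.rpow_eq_zero_iff, hν.Ioi_ne_zero, hq.not_gt]),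
    top_le_iff] at h1
  exact ENNReal.mul_ne_top hD (ENNReal.rpow_ne_top_of_nonneg (by positivity) hVy) h1

include h hν hV hp hq hr hqp in
theorem kernelSup_le {x : ℝ} (hx : 0 ≤ x) (hx0 : ω (Iic x) ≠ 0) (hxt : ω (Iic x) ≠ ∞) :
    kernelSup μ (q / r * (1 + q / (p - q))) (fun y => ν (Ioi y) ^ ((p - 1) * q / (p - q))) x ≤
      (D / ω (Iic x)) ^ (1 + q / (p - q)) := by
  refine iSup₂_le fun y (hy : x < y) => ?_
  have hpq : 0 < p - q := by linarith
  have h1 := h.measure_Iic_mul_le (by linarith) hq hr x y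
  have hVy := hV y (by linarith)
  have hV0 := hν.Ioi_ne_zero y
  have h2 : μ (Ioc x y) ^ (q / r) * ν (Ioi y) ^ (q - q / p) ≤ D / ω (Iic x) := by
    rw [ENNReal.le_div_iff_mul_le (Or.inl hx0) (Or.inl hxt), ENNReal.rpow_sub _ _ hV0 hVy]
    calc _ = (ω (Iic x) * μ (Ioc x y) ^ (q / r) * ν (Ioi y) ^ q) / ν (Ioi y) ^ (q / p) := by
          simp only [div_eq_mul_inv]; ring
      _ ≤ _ := ENNReal.div_le_of_le_mul h1
  refine le_trans (le_of_eq ?_) (ENNReal.rpow_le_rpow h2 (by positivity))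
  rw [ENNReal.mul_rpow_of_nonneg _ _ (by positivity), ← ENNReal.rpow_mul, ← ENNReal.rpow_mul,
    show (q - q / p) * (1 + q / (p - q)) = (p - 1) * q / (p - q) by
      have hp0 : p ≠ 0 := by linarith
      field_simp
      ring]

end TailInequality

end TailInequality

section DyadicNecessity

variable {ω μ ν : Measure ℝ} {p q r : ℝ} {D : ℝ≥0∞}

theorem measure_Iic_add_measure_Ioc (ω : Measure ℝ) {a b : ℝ} (hab : a ≤ b) :
    ω (Iic a) + ω (Ioc a b) = ω (Iic b) := by
  rw [← measure_union (Iic_disjoint_Ioc le_rfl) measurableSet_Ioc, Iic_union_Ioc_eq_Iic hab]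

theorem IsPositiveOnIoi.measure_Iic_lt (hω : IsPositiveOnIoi ω) {a b : ℝ} (ha : 0 ≤ a)
    (hab : a < b) (hfin : ω (Iic a) ≠ ∞) : ω (Iic a) < ω (Iic b) := by
  rw [← measure_Iic_add_measure_Ioc ω hab.le]
  exact ENNReal.lt_add_right hfin (hω.Ioc_ne_zero ha hab)

theorem IsPositiveOnIoi.pos_of_measure_Iic_ne_zero (hω : IsPositiveOnIoi ω) {a : ℝ}
    (ha : ω (Iic a) ≠ 0) : 0 < a := by
  by_contra! h
  exact ha (measure_mono_null (Iic_subset_Iic.2 h) hω.Iic_zero)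

theorem measure_setOf_measure_Iic_lt_le [NullSingletonClass ω] {c : ℝ≥0∞}
    (hW : ∀ t, ω (Iic t) ≠ ∞) (hc : c ≠ 0) : ω {t | ω (Iic t) < c} ≤ c := by
  by_contra! h
  have h1 : c < ω univ := h.trans_le (measure_mono (subset_univ _))
  rw [← iUnion_Iic (α := ℝ), Monotone.measure_iUnion fun a b hab => Iic_subset_Iic.2 hab] at h1
  obtain ⟨t, ht⟩ := lt_iSup_iff.1 h1
  obtain ⟨s, -, hs⟩ := exists_measure_Iic_eq ω hc ht.le (hW t)
  refine h.not_ge ?_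
  rw [← hs]
  refine measure_mono fun u (hu : ω (Iic u) < ω (Iic s)) => ?_
  by_contra hus
  exact hu.not_ge (measure_mono (Iic_subset_Iic.2 (not_le.1 hus).le))

namespace TailInequality

theorem sum_le {ι : Type*} (h : TailInequality ω μ ν p q r D) (hD : D ≠ ∞)
    (hμ : IsPositiveOnIoi μ) (hν : IsPositiveOnIoi ν) (hV : ∀ x, 0 < x → ν (Ioi x) ≠ ∞)
    (hp : 1 < p) (hq : 0 < q) (hr : 0 < r) (hqp : q < p) (s : Finset ι) (z x y : ι → ℝ)
    (hzx : ∀ k ∈ s, z k ≤ x k) (hW0 : ∀ k ∈ s, ω (Iic (x k)) ≠ 0)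
    (hz : ∀ k ∈ s, ω (Iic (z k)) = ω (Iic (x k)) / 2) (hx : ∀ k ∈ s, 0 < x k)
    (hxy : ∀ k ∈ s, x k < y k) (hdisj : (s : Set ι).PairwiseDisjoint fun k => Ioc (z k) (x k)) :
    ∑ k ∈ s, ω (Iic (x k)) ^ (1 + q / (p - q)) * (μ (Ioc (x k) (y k)) ^
      (q / r * (1 + q / (p - q))) * ν (Ioi (y k)) ^ ((p - 1) * q / (p - q))) ≤
      (2 * D) ^ (1 / (1 - q / p)) := by
  have hp0 : 0 < p := by linarith
  have hpq : 0 < p - q := by linarith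
  have hp1 : 0 < p - 1 := by linarith
  have hW := h.measure_Iic_ne_top hD hμ hν hV hp hq hr
  set X : ι → ℝ≥0∞ := fun k => ω (Iic (x k)) ^ (1 + q / (p - q)) * (μ (Ioc (x k) (y k)) ^
      (q / r * (1 + q / (p - q))) * ν (Ioi (y k)) ^ ((p - 1) * q / (p - q))) with hXdef
  have hVy : ∀ k ∈ s, ν (Ioi (y k)) ≠ ∞ := fun k hk => hV _ ((hx k hk).trans (hxy k hk))
  have hXt : ∀ k ∈ s, X k ≠ ∞ := fun k hk => ENNReal.mul_ne_top
    (ENNReal.rpow_ne_top_of_nonneg (by positivity) (hW _)) (ENNReal.mul_ne_top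
      (ENNReal.rpow_ne_top_of_nonneg (by positivity)
        (h.measure_Ioc_ne_top hD hν hV hp hq hr (y k) (hW0 k hk) (hx k hk).le))
      (ENNReal.rpow_ne_top_of_nonneg (by positivity) (hVy k hk)))
  change ∑ k ∈ s, X k ≤ _
  refine ENNReal.le_rpow_of_le_mul_rpow ((div_lt_one hp0).2 hqp) (ENNReal.sum_ne_top.2 hXt) ?_
  set M : ℝ → ℝ≥0∞ := fun t => ∑ k ∈ s, (Ioi (y k)).indicator (fun _ => X k / ν (Ioi (y k))) t
    with hM
  have hMm : Measurable M := Finset.measurable_fun_sum _ fun k _ =>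
    measurable_const.indicator measurableSet_Ioi
  have hMint : ∫⁻ t, (M t ^ (1 / p)) ^ p ∂ν = ∑ k ∈ s, X k := by
    simp only [← ENNReal.rpow_mul, one_div_mul_cancel hp0.ne', ENNReal.rpow_one]
    rw [hM, lintegral_finsetSum _ fun k _ => measurable_const.indicator measurableSet_Ioi]
    refine Finset.sum_congr rfl fun k hk => ?_
    rw [lintegral_indicator_const measurableSet_Ioi,
      ENNReal.div_mul_cancel (hν.Ioi_ne_zero _) (hVy k hk)]
  have htest := h _ (hMm.pow_const (1 / p))
  rw [hMint] at htest
  set F : ℝ → ℝ≥0∞ := fun x => (∫⁻ t in Ioi x, (∫⁻ s in Ioi t, M s ^ (1 / p) ∂ν) ^ r ∂μ) ^ (q / r)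
  have hblock : ∀ k ∈ s, X k / 2 ≤ ∫⁻ t in Ioc (z k) (x k), F t ∂ω := fun k hk => by
    have hV0 := hν.Ioi_ne_zero (y k)
    have hωJ : ω (Ioc (z k) (x k)) = ω (Iic (x k)) / 2 := by
      have h1 := measure_Iic_add_measure_Ioc ω (hzx k hk)
      refine (ENNReal.add_right_inj (ENNReal.div_ne_top (hW (x k)) two_ne_zero)).1 ?_
      rw [ENNReal.add_halves, ← hz k hk, h1]
    have hHy : (X k / ν (Ioi (y k))) ^ (1 / p) * ν (Ioi (y k)) ≤
        ∫⁻ t in Ioi (y k), M t ^ (1 / p) ∂ν := by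
      rw [← setLIntegral_const]
      refine setLIntegral_mono' measurableSet_Ioi fun t ht =>
        ENNReal.rpow_le_rpow ?_ (by positivity)
      refine le_trans (le_of_eq ?_) (Finset.single_le_sum
        (f := fun k => (Ioi (y k)).indicator (fun _ => X k / ν (Ioi (y k))) t)
        (fun _ _ => zero_le) hk)
      simp only [indicator_of_mem ht]
    have hX : X k = X k ^ (q / p) * (ω (Iic (x k)) * (μ (Ioc (x k) (y k)) ^ (q / r) *
        ν (Ioi (y k)) ^ (q - q / p))) := by
      have h1 : X k = X k ^ (q / p) * X k ^ ((p - q) / p) := by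
        rw [← ENNReal.rpow_add_of_nonneg _ _ (by positivity) (by positivity),
          show q / p + (p - q) / p = 1 by field_simp; ring, ENNReal.rpow_one]
      have h2 : X k ^ ((p - q) / p) = ω (Iic (x k)) * (μ (Ioc (x k) (y k)) ^ (q / r) *
          ν (Ioi (y k)) ^ (q - q / p)) := by
        have e1 : (1 + q / (p - q)) * ((p - q) / p) = 1 := by field_simp; ring
        rw [hXdef]
        beta_reduce
        rw [ENNReal.mul_rpow_of_nonneg _ _ (by positivity),
          ENNReal.mul_rpow_of_nonneg _ _ (by positivity), ← ENNReal.rpow_mul, ← ENNReal.rpow_mul,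
          ← ENNReal.rpow_mul, mul_assoc (q / r), e1, mul_one, ENNReal.rpow_one,
          show (p - 1) * q / (p - q) * ((p - q) / p) = q - q / p by field_simp]
      rw [← h2]
      exact h1
    calc X k / 2 = ((X k / ν (Ioi (y k))) ^ (1 / p) * ν (Ioi (y k))) ^ q *
          μ (Ioc (x k) (y k)) ^ (q / r) * ω (Ioc (z k) (x k)) := by
          rw [hωJ, ENNReal.mul_rpow_of_nonneg _ _ hq.le, ← ENNReal.rpow_mul,
            show 1 / p * q = q / p by ring, ENNReal.div_rpow_of_nonneg _ _ (by positivity)]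
          nth_rewrite 1 [hX]
          rw [ENNReal.rpow_sub _ _ hV0 (hVy k hk)]
          simp only [div_eq_mul_inv]
          ring
      _ ≤ _ := by
          rw [← setLIntegral_const]
          refine setLIntegral_mono' measurableSet_Ioc fun t ht => ?_
          refine le_trans ?_ (rpow_tail_mul_rpow_le hr hq.le (x := t) (y := y k))
          gcongr
          exact ht.2
  have hsum : ∑ k ∈ s, X k / 2 ≤ D * (∑ k ∈ s, X k) ^ (q / p) := by
    refine (Finset.sum_le_sum hblock).trans (le_trans ?_ htest)
    rw [← lintegral_biUnion_finset hdisj fun _ _ => measurableSet_Ioc]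
    exact setLIntegral_le_lintegral _ _
  calc ∑ k ∈ s, X k = 2 * ∑ k ∈ s, X k / 2 := by
        rw [Finset.mul_sum]
        exact Finset.sum_congr rfl fun k _ => (ENNReal.mul_div_cancel (by simp) (by simp)).symm
    _ ≤ _ := by rw [mul_assoc]; gcongr

theorem lintegral_rpow_mul_kernelSup_ne_top [NullSingletonClass ω]
    (h : TailInequality ω μ ν p q r D) (hD : D ≠ ∞)
    (hω : IsPositiveOnIoi ω) (hμ : IsPositiveOnIoi μ) (hν : IsPositiveOnIoi ν)
    (hV : ∀ x, 0 < x → ν (Ioi x) ≠ ∞)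
    (hp : 1 < p) (hq : 0 < q) (hr : 0 < r) (hqp : q < p) :
    ∫⁻ t, ω (Iic t) ^ (q / (p - q)) * kernelSup μ (q / r * (1 + q / (p - q)))
      (fun y => ν (Ioi y) ^ ((p - 1) * q / (p - q))) t ∂ω ≠ ∞ := by
  have hpq : 0 < p - q := by linarith
  have hp1 : 0 < p - 1 := by linarith
  have hW := h.measure_Iic_ne_top hD hμ hν hV hp hq hr
  have hφ : ∀ y, 0 < y → ν (Ioi y) ^ ((p - 1) * q / (p - q)) ≠ 0 := fun y _ => by
    have : 0 ≤ (p - 1) * q / (p - q) := by positivity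
    simp [ENNReal.rpow_eq_zero_iff, hν.Ioi_ne_zero y, this.not_gt]
  set φ : ℝ → ℝ≥0∞ := fun y => ν (Ioi y) ^ ((p - 1) * q / (p - q)) with hφdef
  set θ := q / (p - q) with hθdef
  have hθ : 0 < θ := by positivity
  have hα' : 0 ≤ q / r * (1 + θ) := by positivity
  set Ψ := kernelSup μ (q / r * (1 + θ)) φ with hΨ
  have h2k : ∀ k : ℤ, (2 : ℝ≥0∞) ^ k ≠ 0 := fun k => (ENNReal.zpow_pos (by simp) (by simp) k).ne'
  have h2t : ∀ k : ℤ, (2 : ℝ≥0∞) ^ k ≠ ∞ := fun k => (ENNReal.zpow_lt_top (by simp) (by simp) k).ne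
  set K : Set ℤ := {k | ∃ t, (2 : ℝ≥0∞) ^ k ≤ ω (Iic t)} with hK
  have hx : ∀ k : ℤ, ∃ x, k ∈ K → ω (Iic x) = 2 ^ k := fun k => by
    by_cases hk : k ∈ K
    · obtain ⟨t, ht⟩ := hk
      obtain ⟨x, -, hx⟩ := exists_measure_Iic_eq ω (h2k k) ht (hW t)
      exact ⟨x, fun _ => hx⟩
    · exact ⟨0, fun h => absurd h hk⟩
  choose x hx using hx
  have hx0 : ∀ k ∈ K, 0 < x k := fun k hk =>
    hω.pos_of_measure_Iic_ne_zero (by rw [hx k hk]; exact h2k k)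
  have hy : ∀ k : ℤ, ∃ y, k ∈ K → x k < y ∧
      Ψ (x k) ≤ 2 * (μ (Ioc (x k) y) ^ (q / r * (1 + θ)) * φ y) := fun k => by
    by_cases hk : k ∈ K
    · have hΨ0 : Ψ (x k) ≠ 0 := kernelSup_ne_zero hμ hα' hφ (hx0 k hk)
      have hΨt : Ψ (x k) ≠ ∞ := by
        have hWx : ω (Iic (x k)) ≠ 0 := by rw [hx k hk]; exact h2k k
        refine ne_top_of_le_ne_top ?_ (h.kernelSup_le hν hV hp hq hr hqp (hx0 k hk).le hWx (hW _))
        exact ENNReal.rpow_ne_top_of_nonneg (by positivity) (ENNReal.div_ne_top hD hWx)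
      obtain ⟨y, hy⟩ := lt_iSup_iff.1 (ENNReal.half_lt_self hΨ0 hΨt)
      obtain ⟨hxy, hy⟩ := lt_iSup_iff.1 hy
      refine ⟨y, fun _ => ⟨hxy, ?_⟩⟩
      calc Ψ (x k) = 2 * (Ψ (x k) / 2) := (ENNReal.mul_div_cancel (by simp) (by simp)).symm
        _ ≤ _ := by
          gcongr
          exact hy.le
    · exact ⟨0, fun h => absurd h hk⟩
  choose y hy using hy
  set X : ℤ → ℝ≥0∞ := fun k => ω (Iic (x k)) ^ (1 + θ) *
    (μ (Ioc (x k) (y k)) ^ (q / r * (1 + θ)) * φ (y k)) with hX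
  set I : ℤ → Set ℝ := fun k => {t | 0 < t ∧ ω (Iic t) ∈ Ico ((2 : ℝ≥0∞) ^ k) (2 ^ (k + 1))} with hI
  have hKpred : ∀ k ∈ K, k - 1 ∈ K := fun k ⟨t, ht⟩ => ⟨t, le_trans
    (ENNReal.zpow_le_of_le (by simp) (by omega)) ht⟩
  have hblock : ∀ k ∈ K, ∫⁻ t in I k, ω (Iic t) ^ θ * Ψ t ∂ω ≤ 2 ^ (1 + θ) * 2 * X k := by
    intro k hk
    have hIm : MeasurableSet (I k) :=
      measurableSet_Ioi.inter ((measurable_measure_Iic ω) measurableSet_Ico)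
    have hωI : ω (I k) ≤ 2 ^ (k + 1) :=
      (measure_mono fun t ht => ht.2.2).trans (measure_setOf_measure_Iic_lt_le hW (h2k _))
    calc _ ≤ ∫⁻ t in I k, ((2 : ℝ≥0∞) ^ (k + 1)) ^ θ * Ψ (x k) ∂ω := by
          refine setLIntegral_mono' hIm fun t ht => ?_
          refine mul_le_mul' (ENNReal.rpow_le_rpow ht.2.2.le hθ.le) (kernelSup_antitone hα' ?_)
          by_contra! hlt
          have := hω.measure_Iic_lt ht.1.le hlt (hW t)
          rw [hx k hk] at this
          exact this.not_ge ht.2.1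
      _ ≤ ((2 : ℝ≥0∞) ^ (k + 1)) ^ θ * Ψ (x k) * 2 ^ (k + 1) := by
          rw [setLIntegral_const]
          gcongr
      _ = ((2 : ℝ≥0∞) ^ (k + 1)) ^ (1 + θ) * Ψ (x k) := by
          rw [ENNReal.rpow_add_of_nonneg _ _ zero_le_one hθ.le, ENNReal.rpow_one]
          ring
      _ ≤ ((2 : ℝ≥0∞) ^ (k + 1)) ^ (1 + θ) *
          (2 * (μ (Ioc (x k) (y k)) ^ (q / r * (1 + θ)) * φ (y k))) := by
          gcongr
          exact (hy k hk).2
      _ = _ := by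
          rw [hX]
          beta_reduce
          rw [hx k hk, ENNReal.zpow_add (by simp) (by simp), zpow_one,
            ENNReal.mul_rpow_of_nonneg _ _ (by positivity)]
          ring
  have hIempty : ∀ k ∉ K, I k = ∅ := fun k hk => by
    refine eq_empty_of_forall_notMem fun t ht => hk ⟨t, ht.2.1⟩
  have hcover : ∫⁻ t, ω (Iic t) ^ θ * Ψ t ∂ω ≤ ∑' k, ∫⁻ t in I k, ω (Iic t) ^ θ * Ψ t ∂ω := by
    refine le_trans (le_of_eq ?_) (lintegral_iUnion_le I _)
    rw [← setLIntegral_univ]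
    refine setLIntegral_congr ?_
    filter_upwards [hω.ae_pos] with t ht
    refine propext ⟨fun _ => ?_, fun _ => trivial⟩
    obtain ⟨k, hk⟩ := ENNReal.exists_mem_Ico_zpow (hω.Iic_ne_zero ht) (hW t)
      (by norm_num : (1 : ℝ≥0∞) < 2) (by simp)
    exact mem_iUnion.2 ⟨k, ht, hk⟩
  refine ne_top_of_le_ne_top (b := 2 ^ (1 + θ) * 2 * (2 * D) ^ (1 / (1 - q / p))) ?_
    (hcover.trans ?_)
  · have : 0 < 1 - q / p := sub_pos.2 ((div_lt_one (by linarith)).2 hqp)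
    exact ENNReal.mul_ne_top (ENNReal.mul_ne_top (ENNReal.rpow_ne_top_of_nonneg (by positivity)
      (by simp)) (by simp)) (ENNReal.rpow_ne_top_of_nonneg (by positivity)
        (ENNReal.mul_ne_top (by simp) hD))
  · classical
    rw [ENNReal.tsum_eq_iSup_sum]
    refine iSup_le fun s => ?_
    calc _ = ∑ k ∈ s with k ∈ K, ∫⁻ t in I k, ω (Iic t) ^ θ * Ψ t ∂ω := by
          refine (Finset.sum_filter_of_ne fun k _ hk => ?_).symm
          by_contra hkK
          exact hk (by rw [hIempty k hkK]; simp)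
      _ ≤ ∑ k ∈ s with k ∈ K, 2 ^ (1 + θ) * 2 * X k :=
          Finset.sum_le_sum fun k hk => hblock k (Finset.mem_filter.1 hk).2
      _ ≤ _ := by
          rw [← Finset.mul_sum]
          refine mul_le_mul_right ?_ _
          have hmem : ∀ k ∈ s.filter (· ∈ K), k ∈ K := fun k hk => (Finset.mem_filter.1 hk).2
          have hmono : ∀ j ∈ K, ∀ k ∈ K, j ≤ k → x j ≤ x k := fun j hj k hk hjk => by
            by_contra! hlt
            have := hω.measure_Iic_lt (hx0 k hk).le hlt (hW _)
            rw [hx k hk, hx j hj] at this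
            exact this.not_ge (ENNReal.zpow_le_of_le (by simp) hjk)
          refine h.sum_le hD hμ hν hV hp hq hr hqp _ (fun k => x (k - 1)) x y
            (fun k hk => hmono _ (hKpred k (hmem k hk)) _ (hmem k hk) (by omega))
            (fun k hk => by rw [hx k (hmem k hk)]; exact h2k k)
            (fun k hk => ?_) (fun k hk => hx0 k (hmem k hk)) (fun k hk => (hy k (hmem k hk)).1) ?_
          · rw [hx k (hmem k hk), hx _ (hKpred k (hmem k hk)), ENNReal.zpow_sub (by simp) (by simp),
              zpow_one, div_eq_mul_inv]
          · have hdisj : ∀ j ∈ K, ∀ k ∈ K, j < k →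
                Disjoint (Ioc (x (j - 1)) (x j)) (Ioc (x (k - 1)) (x k)) := fun j hj k hk hjk =>
              Ioc_disjoint_Ioc_of_le (hmono j hj _ (hKpred k hk) (by omega))
            intro j hj k hk hjk
            rcases lt_or_gt_of_ne hjk with hlt | hlt
            · exact hdisj j (hmem j hj) k (hmem k hk) hlt
            · exact (hdisj k (hmem k hk) j (hmem j hj) hlt).symm

end TailInequality

end DyadicNecessity

section ResolventMeasure

variable {ω μ : Measure ℝ} {α : ℝ}

theorem ae_measure_Iic_ne_zero [NullSingletonClass ω] (hW : ∀ t, ω (Iic t) ≠ ∞) :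
    ∀ᵐ t ∂ω, ω (Iic t) ≠ 0 := by
  rw [ae_iff]
  refine le_antisymm (ENNReal.le_of_forall_pos_le_add fun ε hε _ => ?_) zero_le
  rw [zero_add]
  have h0 : (ε : ℝ≥0∞) ≠ 0 := by simpa using hε.ne'
  refine (measure_mono fun t ht => ?_).trans (measure_setOf_measure_Iic_lt_le hW h0)
  have ht : ω (Iic t) = 0 := by simpa using ht
  simpa [ht] using hε

theorem setLIntegral_Ioi_rpow_neg_two_le [NullSingletonClass ω] (hW : ∀ t, ω (Iic t) ≠ ∞) {b : ℝ}
    (hb : ω (Iic b) ≠ 0) : ∫⁻ s in Ioi b, ω (Iic s) ^ (-2 : ℝ) ∂ω ≤ (ω (Iic b))⁻¹ := by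
  have := mul_setLIntegral_Ioi_rpow_neg_le ω zero_lt_one hb hW
  rwa [ENNReal.ofReal_one, one_mul, ENNReal.rpow_neg_one,
    show (-1 : ℝ) - 1 = -2 by norm_num] at this

theorem inv_add_setLIntegral_Ioc_rpow_neg_two [NullSingletonClass ω] {b t : ℝ} (hbt : b ≤ t)
    (hb : ω (Iic b) ≠ 0) (ht : ω (Iic t) ≠ ∞) :
    (ω (Iic t))⁻¹ + ∫⁻ s in Ioc b t, ω (Iic s) ^ (-2 : ℝ) ∂ω = (ω (Iic b))⁻¹ := by
  have := rpow_neg_add_mul_setLIntegral_Ioc_rpow ω zero_lt_one hbt hb ht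
  rwa [ENNReal.ofReal_one, one_mul, ENNReal.rpow_neg_one, ENNReal.rpow_neg_one,
    show (-1 : ℝ) - 1 = -2 by norm_num] at this

/-- Tonelli's theorem combined with the bound `∫_{(b, ∞)} ω(-∞, t]⁻² dω(t) ≤ ω(-∞, b]⁻¹`. -/
theorem lintegral_rpow_neg_two_mul_setLIntegral_le [SFinite ω] [NullSingletonClass ω]
    (hW : ∀ t, ω (Iic t) ≠ ∞) {f : ℝ → ℝ → ℝ≥0∞} (hf : Measurable (Function.uncurry f))
    {g : ℝ → ℝ≥0∞} (hfg : ∀ᵐ b ∂ω, ∀ t, b < t → f b t ≤ ω (Iic b) * g b) :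
    ∫⁻ t, ω (Iic t) ^ (-2 : ℝ) * ∫⁻ b in Iic t, f b t ∂ω ∂ω ≤ ∫⁻ b, g b ∂ω := by
  have hWm := (measurable_measure_Iic ω).pow_const (-2 : ℝ)
  have hfm : Measurable (Function.uncurry fun b t => ω (Iic t) ^ (-2 : ℝ) * f b t) :=
    (hWm.comp measurable_snd).mul hf
  calc _ = ∫⁻ t, ∫⁻ b in Iio t, ω (Iic t) ^ (-2 : ℝ) * f b t ∂ω ∂ω := by
        refine lintegral_congr fun t => ?_
        rw [setLIntegral_congr (Iio_ae_eq_Iic (μ := ω)), lintegral_const_mul]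
        exact hf.comp (measurable_id.prodMk measurable_const)
    _ = ∫⁻ b, ∫⁻ t in Ioi b, ω (Iic t) ^ (-2 : ℝ) * f b t ∂ω ∂ω :=
        (lintegral_lintegral_Ioi_swap hfm).symm
    _ ≤ ∫⁻ b, g b ∂ω := by
        refine lintegral_mono_ae ?_
        filter_upwards [hfg, ae_measure_Iic_ne_zero hW] with b hb hb0
        calc _ ≤ ∫⁻ t in Ioi b, ω (Iic t) ^ (-2 : ℝ) * (ω (Iic b) * g b) ∂ω :=
              setLIntegral_mono' measurableSet_Ioi fun t ht => mul_le_mul_right (hb t ht) _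
          _ = (∫⁻ t in Ioi b, ω (Iic t) ^ (-2 : ℝ) ∂ω) * (ω (Iic b) * g b) :=
              lintegral_mul_const _ hWm
          _ ≤ (ω (Iic b))⁻¹ * (ω (Iic b) * g b) := by
              gcongr
              exact setLIntegral_Ioi_rpow_neg_two_le hW hb0
          _ = g b := by
              rw [← mul_assoc, ENNReal.inv_mul_cancel hb0 (hW b), one_mul]

/-- The function `t ↦ ∫_{(-∞, t]} ω(-∞, s] μ((s, t])^α dω(s)`. -/
def weightedPrimitive (ω μ : Measure ℝ) (α t : ℝ) : ℝ≥0∞ :=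
  ∫⁻ s in Iic t, ω (Iic s) * μ (Ioc s t) ^ α ∂ω

theorem weightedPrimitive_mono (hα : 0 ≤ α) : Monotone (weightedPrimitive ω μ α) := fun _ _ hst =>
  (lintegral_mono fun b => mul_le_mul_right (ENNReal.rpow_le_rpow
    (measure_mono (Ioc_subset_Ioc_right hst)) hα) (ω (Iic b))).trans
      (lintegral_mono_set (Iic_subset_Iic.2 hst))

/-- The measure with density `ω(-∞, t]⁻² ∫_{(-∞, t]} ω(-∞, s] μ((s, t])^α dω(s)` against `ω`. -/
def resolventMeasure (ω μ : Measure ℝ) (α : ℝ) : Measure ℝ :=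
  ω.withDensity fun t => ω (Iic t) ^ (-2 : ℝ) * weightedPrimitive ω μ α t

instance [SFinite ω] : SFinite (resolventMeasure ω μ α) := by
  unfold resolventMeasure
  infer_instance

instance [NullSingletonClass ω] : NullSingletonClass (resolventMeasure ω μ α) :=
  ⟨fun x => withDensity_absolutelyContinuous _ _ (measure_singleton x)⟩

theorem resolventMeasure_apply {s : Set ℝ} (hs : MeasurableSet s) : resolventMeasure ω μ α s =
    ∫⁻ t in s, ω (Iic t) ^ (-2 : ℝ) * weightedPrimitive ω μ α t ∂ω :=
  withDensity_apply _ hs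

theorem measurable_weightedPrimitive (hα : 0 ≤ α) : Measurable (weightedPrimitive ω μ α) :=
  (weightedPrimitive_mono hα).measurable

variable {a N : ℝ}

theorem ae_mem_Ioc (ha : ω (Iic a) = 0) (hN : ω (Ioi N) = 0) : ∀ᵐ t ∂ω, t ∈ Ioc a N := by
  have h1 := measure_eq_zero_iff_ae_notMem.1 ha
  have h2 := measure_eq_zero_iff_ae_notMem.1 hN
  filter_upwards [h1, h2] with t h1 h2
  exact ⟨not_le.1 h1, not_lt.1 h2⟩

theorem resolventMeasure_univ_le [IsFiniteMeasure ω] [NullSingletonClass ω] (hα : 0 ≤ α)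
    (ha : ω (Iic a) = 0) (hN : ω (Ioi N) = 0) :
    resolventMeasure ω μ α univ ≤ μ (Ioc a N) ^ α * ω univ := by
  have hω := ae_mem_Ioc ha hN
  have hW : ∀ t, ω (Iic t) ≠ ∞ := fun t => measure_ne_top _ _
  rw [resolventMeasure_apply MeasurableSet.univ, setLIntegral_univ, ← lintegral_const]
  refine lintegral_mono_ae ?_
  filter_upwards [hω, ae_measure_Iic_ne_zero hW] with t ht ht0
  have h1 : weightedPrimitive ω μ α t ≤ ω (Iic t) ^ (2 : ℝ) * μ (Ioc a N) ^ α := by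
    calc _ ≤ ∫⁻ _ in Iic t, ω (Iic t) * μ (Ioc a N) ^ α ∂ω := by
          refine lintegral_mono_ae ?_
          filter_upwards [ae_restrict_of_ae hω, ae_restrict_mem measurableSet_Iic] with b hb hbt
          gcongr
          exacts [hbt, hb.1.le, ht.2]
      _ = _ := by
          rw [setLIntegral_const, ENNReal.rpow_two]
          ring
  calc _ ≤ ω (Iic t) ^ (-2 : ℝ) * (ω (Iic t) ^ (2 : ℝ) * μ (Ioc a N) ^ α) := by gcongr
    _ = _ := by
      rw [← mul_assoc, ← ENNReal.rpow_add _ _ ht0 (hW t), neg_add_cancel, ENNReal.rpow_zero,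
        one_mul]

theorem kernelPrimitive_ne_top_of_measure_Ioc [IsFiniteMeasure ω] (hα : 0 ≤ α) (ha : ω (Iic a) = 0)
    (hU : μ (Ioc a N) ≠ ∞) {t : ℝ} (ht : t ≤ N) : kernelPrimitive ω μ α t ≠ ∞ := by
  have h1 := measure_eq_zero_iff_ae_notMem.1 ha
  refine ne_top_of_le_ne_top (b := μ (Ioc a N) ^ α * ω (Iic t))
    (ENNReal.mul_ne_top (ENNReal.rpow_ne_top_of_nonneg hα hU) (measure_ne_top _ _)) ?_
  rw [← setLIntegral_const]
  refine lintegral_mono_ae ?_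
  filter_upwards [ae_restrict_of_ae h1] with b hb
  gcongr
  exact (not_le.1 hb).le

theorem kernelPrimitive_le_resolventMeasure_add [IsFiniteMeasure ω] [NullSingletonClass ω]
    [SFinite μ] (hα : 0 ≤ α) (hα1 : α ≤ 1) {s : ℝ} :
    kernelPrimitive ω μ α s ≤ weightedPrimitive ω μ α s * (ω (Iic s))⁻¹ +
      (resolventMeasure ω μ α (Iic s) + kernelPrimitive ω μ α s / 2) := by
  have hW : ∀ t, ω (Iic t) ≠ ∞ := fun t => measure_ne_top _ _
  have hWm := measurable_measure_Iic ω
  have hW2 := hWm.pow_const (-2 : ℝ)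
  have hU := (measurable_measure_Ioc μ).pow_const α
  have hUs : Measurable fun b => μ (Ioc b s) ^ α :=
    hU.comp (measurable_id.prodMk measurable_const)
  have hWU : ∀ τ, Measurable fun b => ω (Iic b) * μ (Ioc b τ) ^ α := fun τ =>
    hWm.mul (hU.comp (measurable_id.prodMk measurable_const))
  have hdens : Measurable fun τ => ω (Iic τ) ^ (-2 : ℝ) * weightedPrimitive ω μ α τ :=
    hW2.mul (measurable_weightedPrimitive hα)
  set ρ := ω.restrict (Iic s) with hρ
  have hρ1 : ∀ b, ρ.restrict (Ioi b) = ω.restrict (Ioc b s) := fun b => by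
    rw [hρ, Measure.restrict_restrict measurableSet_Ioi, Ioi_inter_Iic]
  have hρ2 : ∀ b ≤ s, ρ.restrict (Iio b) = ω.restrict (Iic b) := fun b hb => by
    rw [hρ, Measure.restrict_restrict measurableSet_Iio,
      inter_eq_left.2 ((Iio_subset_Iic_self).trans (Iic_subset_Iic.2 hb))]
    exact Measure.restrict_congr_set Iio_ae_eq_Iic
  have hg : Measurable (Function.uncurry fun b τ : ℝ => ω (Iic τ) ^ (-2 : ℝ) *
      (ω (Iic b) * μ (Ioc b τ) ^ α + μ (Ioc τ s) ^ α * ω (Iic b))) :=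
    (hW2.comp measurable_snd).mul (((hWm.comp measurable_fst).mul hU).add
      ((hUs.comp measurable_snd).mul (hWm.comp measurable_fst)))
  calc kernelPrimitive ω μ α s ≤ ∫⁻ b, (ω (Iic b) * μ (Ioc b s) ^ α * (ω (Iic s))⁻¹ +
        ∫⁻ τ in Ioi b, ω (Iic τ) ^ (-2 : ℝ) *
          (ω (Iic b) * μ (Ioc b τ) ^ α + μ (Ioc τ s) ^ α * ω (Iic b)) ∂ρ) ∂ρ := by
        refine lintegral_mono_ae ?_
        filter_upwards [ae_restrict_of_ae (ae_measure_Iic_ne_zero hW),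
          ae_restrict_mem measurableSet_Iic] with b hb0 hbs
        calc _ = ω (Iic b) * μ (Ioc b s) ^ α * ((ω (Iic s))⁻¹ +
              ∫⁻ τ in Ioc b s, ω (Iic τ) ^ (-2 : ℝ) ∂ω) := by
              rw [inv_add_setLIntegral_Ioc_rpow_neg_two hbs hb0 (hW s), mul_right_comm,
                ENNReal.mul_inv_cancel hb0 (hW b), one_mul]
          _ ≤ _ := by
              rw [mul_add, hρ1, ← lintegral_const_mul _ hW2]
              refine add_le_add le_rfl (setLIntegral_mono' measurableSet_Ioc fun τ hτ => ?_)
              calc _ ≤ ω (Iic b) * (μ (Ioc b τ) ^ α + μ (Ioc τ s) ^ α) *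
                    ω (Iic τ) ^ (-2 : ℝ) := by
                    gcongr
                    exact measure_Ioc_rpow_le_add hα hα1 hτ.1.le hτ.2
                _ = _ := by ring
    _ = weightedPrimitive ω μ α s * (ω (Iic s))⁻¹ + ∫⁻ τ, ∫⁻ b in Iio τ, ω (Iic τ) ^ (-2 : ℝ) *
          (ω (Iic b) * μ (Ioc b τ) ^ α + μ (Ioc τ s) ^ α * ω (Iic b)) ∂ρ ∂ρ := by
        rw [lintegral_add_left ((hWU s).mul_const _), lintegral_lintegral_Ioi_swap hg,
          lintegral_mul_const _ (hWU s)]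
        rfl
    _ ≤ _ := by
        refine add_le_add le_rfl ?_
        rw [resolventMeasure_apply measurableSet_Iic, kernelPrimitive, div_eq_mul_inv,
          ← lintegral_mul_const _ hUs,
          ← lintegral_add_left hdens]
        refine lintegral_mono_ae ?_
        filter_upwards [ae_restrict_of_ae (ae_measure_Iic_ne_zero hW),
          ae_restrict_mem measurableSet_Iic] with τ hτ0 hτs
        have h2 : ω (Iic τ) ^ (-2 : ℝ) * ∫⁻ b in Iic τ, ω (Iic b) ∂ω = 2⁻¹ := by
          have h1 := mul_setLIntegral_Iic_rpow ω zero_lt_two (hW τ)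
          norm_num only [ENNReal.rpow_one] at h1
          rw [ENNReal.ofReal_ofNat] at h1
          have h3 : ω (Iic τ) ^ (-2 : ℝ) * ω (Iic τ) ^ (2 : ℝ) = 1 := by
            rw [← ENNReal.rpow_add _ _ hτ0 (hW τ), neg_add_cancel, ENNReal.rpow_zero]
          rw [← h1, mul_left_comm] at h3
          exact ENNReal.eq_inv_of_mul_eq_one_left (by rwa [mul_comm])
        have hadd : Measurable fun b => ω (Iic b) * μ (Ioc b τ) ^ α + μ (Ioc τ s) ^ α * ω (Iic b) :=
          (hWU τ).add (hWm.const_mul _)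
        rw [hρ2 τ hτs, lintegral_const_mul _ hadd,
          lintegral_add_left (hWU τ), lintegral_const_mul _ hWm, mul_add, mul_left_comm, h2]
        rfl

theorem kernelPrimitive_le_four_mul_resolventMeasure [IsFiniteMeasure ω] [NullSingletonClass ω]
    [SFinite μ] (hα : 0 ≤ α) (hα1 : α ≤ 1)
    {s t : ℝ} (hst : s ≤ t) (hs : ω (Iic s) = ω (Iic t) / 2) (ht : ω (Iic t) ≠ 0)
    (hS : kernelPrimitive ω μ α s ≠ ∞) :
    kernelPrimitive ω μ α s ≤ 4 * resolventMeasure ω μ α (Iic t) := by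
  have hW : ∀ t, ω (Iic t) ≠ ∞ := fun t => measure_ne_top _ _
  have hs0 : ω (Iic s) ≠ 0 := by rw [hs]; simpa using ht
  have ht2 : ω (Iic t) = 2 * ω (Iic s) := by
    rw [hs, ENNReal.mul_div_cancel two_ne_zero ENNReal.ofNat_ne_top]
  have hJ : (ω (Iic s))⁻¹ = 2 * ∫⁻ τ in Ioc s t, ω (Iic τ) ^ (-2 : ℝ) ∂ω := by
    have h1 := inv_add_setLIntegral_Ioc_rpow_neg_two hst hs0 (hW t)
    have h2 : (ω (Iic t))⁻¹ = (ω (Iic s))⁻¹ / 2 := by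
      rw [ht2, ENNReal.mul_inv (by simp) (by simp), mul_comm, div_eq_mul_inv]
    have h3 : ∫⁻ τ in Ioc s t, ω (Iic τ) ^ (-2 : ℝ) ∂ω = (ω (Iic s))⁻¹ / 2 := by
      refine (ENNReal.add_right_inj (a := (ω (Iic s))⁻¹ / 2) ?_).1 ?_
      · exact ENNReal.div_ne_top (by simpa using hs0) two_ne_zero
      · rw [ENNReal.add_halves, ← h2, h1]
    rw [h3, ENNReal.mul_div_cancel two_ne_zero ENNReal.ofNat_ne_top]
  have hL : weightedPrimitive ω μ α s * (ω (Iic s))⁻¹ ≤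
      2 * resolventMeasure ω μ α (Ioc s t) := by
    rw [hJ, mul_left_comm, ← lintegral_const_mul _ ((measurable_measure_Iic ω).pow_const _),
      resolventMeasure_apply measurableSet_Ioc]
    refine mul_le_mul_right (setLIntegral_mono' measurableSet_Ioc fun τ hτ => ?_) _
    rw [mul_comm]
    exact mul_le_mul_right (weightedPrimitive_mono hα hτ.1.le) _
  have hsum : kernelPrimitive ω μ α s ≤
      2 * resolventMeasure ω μ α (Iic t) + kernelPrimitive ω μ α s / 2 := by
    calc _ ≤ _ := kernelPrimitive_le_resolventMeasure_add hα hα1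
      _ ≤ 2 * resolventMeasure ω μ α (Ioc s t) + (2 * resolventMeasure ω μ α (Iic s) +
          kernelPrimitive ω μ α s / 2) := by
          gcongr
          exact le_mul_of_one_le_left zero_le one_le_two
      _ = _ := by
          rw [← measure_Iic_add_measure_Ioc _ hst]
          ring
  have hS2 : kernelPrimitive ω μ α s / 2 ≠ ∞ := ENNReal.div_ne_top hS two_ne_zero
  nth_rewrite 1 [← ENNReal.add_halves (kernelPrimitive ω μ α s)] at hsum
  have hhalf := (ENNReal.add_le_add_iff_right hS2).1 hsum
  calc kernelPrimitive ω μ α s = 2 * (kernelPrimitive ω μ α s / 2) :=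
        (ENNReal.mul_div_cancel two_ne_zero ENNReal.ofNat_ne_top).symm
    _ ≤ 2 * (2 * resolventMeasure ω μ α (Iic t)) := by gcongr
    _ = _ := by ring

end ResolventMeasure

section ResolventTest

variable {ω μ ν ρ : Measure ℝ} {p q r α θ κ : ℝ} {D : ℝ≥0∞}

theorem mul_lintegral_rpow_mul_rpow_eq [IsFiniteMeasure ρ] [NullSingletonClass ρ] [SFinite ν]
    [NullSingletonClass ν] (hρ : ∀ᵐ x ∂ρ, 0 < x) (hV : ∀ x, 0 < x → ν (Ioi x) ≠ ∞)
    (hθ : 0 < θ) (hκ : 0 < κ) :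
    ENNReal.ofReal κ * ∫⁻ z, ρ (Iic z) ^ (1 + θ) * ν (Ioi z) ^ (κ - 1) ∂ν =
      ENNReal.ofReal (1 + θ) * ∫⁻ s, ρ (Iic s) ^ θ * ν (Ioi s) ^ κ ∂ρ := by
  have hMm := (measurable_measure_Iic ρ).pow_const θ
  have hVm := (measurable_measure_Ioi ν).pow_const (κ - 1)
  have hf : Measurable (Function.uncurry fun s z => ρ (Iic s) ^ θ * ν (Ioi z) ^ (κ - 1)) :=
    (hMm.comp measurable_fst).mul (hVm.comp measurable_snd)
  have h1 : ∫⁻ z, ρ (Iic z) ^ (1 + θ) * ν (Ioi z) ^ (κ - 1) ∂ν = ENNReal.ofReal (1 + θ) *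
      ∫⁻ z, ∫⁻ s in Iio z, ρ (Iic s) ^ θ * ν (Ioi z) ^ (κ - 1) ∂ρ ∂ν := by
    rw [← lintegral_const_mul' _ _ ENNReal.ofReal_ne_top]
    refine lintegral_congr fun z => ?_
    have h2 := mul_setLIntegral_Iic_rpow ρ (by linarith : 0 < 1 + θ) (measure_ne_top ρ (Iic z))
    rw [add_sub_cancel_left] at h2
    rw [setLIntegral_congr (Iio_ae_eq_Iic (μ := ρ)), lintegral_mul_const _ hMm, ← mul_assoc, h2]
  rw [h1, mul_left_comm, ← lintegral_lintegral_Ioi_swap hf,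
    ← lintegral_const_mul' _ _ ENNReal.ofReal_ne_top]
  congr 1
  refine lintegral_congr_ae ?_
  filter_upwards [hρ] with s hs
  rw [lintegral_const_mul _ hVm, mul_left_comm, mul_setLIntegral_Ioi_rpow ν hκ (hV s hs)]

theorem lintegral_resolventMeasure_le [IsFiniteMeasure ω] [NullSingletonClass ω] [SFinite μ]
    (hα : 0 ≤ α) {φ : ℝ → ℝ≥0∞} (hφ : Measurable φ) :
    ∫⁻ t, φ t ∂(resolventMeasure ω μ α) ≤ ∫⁻ t, kernelSup μ α φ t ∂ω := by
  have hW : ∀ t, ω (Iic t) ≠ ∞ := fun t => measure_ne_top _ _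
  have hWm := measurable_measure_Iic ω
  have hU := (measurable_measure_Ioc μ).pow_const α
  have hdens : Measurable fun τ => ω (Iic τ) ^ (-2 : ℝ) * weightedPrimitive ω μ α τ :=
    (hWm.pow_const _).mul (measurable_weightedPrimitive hα)
  have hf : Measurable (Function.uncurry fun b t => ω (Iic b) * μ (Ioc b t) ^ α * φ t) :=
    ((hWm.comp measurable_fst).mul hU).mul (hφ.comp measurable_snd)
  refine le_trans (le_of_eq ?_) (lintegral_rpow_neg_two_mul_setLIntegral_le hW hf
    (.of_forall fun b t hbt => ?_))
  · rw [resolventMeasure, lintegral_withDensity_eq_lintegral_mul _ hdens hφ]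
    refine lintegral_congr fun t => ?_
    have hWU : Measurable fun b => ω (Iic b) * μ (Ioc b t) ^ α :=
      hWm.mul (hU.comp (measurable_id.prodMk measurable_const))
    rw [lintegral_mul_const _ hWU, Pi.mul_apply, mul_assoc]
    rfl
  · rw [mul_assoc]
    exact mul_le_mul_right (le_kernelSup hbt) _

theorem TailInequality.lintegral_kernelSup_le [SFinite ν] [NullSingletonClass ν]
    (h : TailInequality ω μ ν p q r D) (hω : ∀ᵐ x ∂ω, 0 < x)
    (hV : ∀ x, 0 < x → ν (Ioi x) ≠ ∞) (hp : 1 < p) (hq : 0 < q) (hr : 0 < r) (hqp : q < p)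
    {M : ℝ → ℝ≥0∞} (hM : Monotone M) :
    ∫⁻ x, kernelSup μ (q / r)
      (fun y => M y ^ (q / (p - q)) * ν (Ioi y) ^ ((p - 1) * q / (p - q))) x ∂ω ≤
      ENNReal.ofReal ((p - 1) / (p - q)) ^ q * (D *
        (∫⁻ z, M z ^ (1 + q / (p - q)) * ν (Ioi z) ^ ((p - 1) * q / (p - q) - 1) ∂ν) ^
          (q / p)) := by
  have hp0 : 0 < p := by linarith
  have hpq : 0 < p - q := by linarith
  have hp1 : 0 < p - 1 := by linarith
  have hγ : 0 < (p - 1) / (p - q) := by positivity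
  set m : ℝ → ℝ≥0∞ := fun s => M s ^ (1 / (p - q)) * ν (Ioi s) ^ ((p - 1) / (p - q) - 1) with hm
  have hVm := measurable_measure_Ioi ν
  have hmm : Measurable m := (hM.measurable.pow_const _).mul (hVm.pow_const _)
  have hmp : ∀ s, m s ^ p =
      M s ^ (1 + q / (p - q)) * ν (Ioi s) ^ ((p - 1) * q / (p - q) - 1) := fun s => by
    rw [hm]
    beta_reduce
    rw [ENNReal.mul_rpow_of_nonneg _ _ hp0.le, ← ENNReal.rpow_mul, ← ENNReal.rpow_mul,
      show 1 / (p - q) * p = 1 + q / (p - q) by field_simp; ring,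
      show ((p - 1) / (p - q) - 1) * p = (p - 1) * q / (p - q) - 1 by field_simp; ring]
  have htest := h m hmm
  simp only [hmp] at htest
  refine le_trans ?_ (mul_le_mul_right htest _)
  rw [← lintegral_const_mul' _ _ (ENNReal.rpow_ne_top_of_nonneg hq.le ENNReal.ofReal_ne_top)]
  refine lintegral_mono_ae ?_
  filter_upwards [hω] with x hx
  refine iSup₂_le fun y (hy : x < y) => ?_
  have hH : M y ^ (1 / (p - q)) * ν (Ioi y) ^ ((p - 1) / (p - q)) ≤
      ENNReal.ofReal ((p - 1) / (p - q)) * ∫⁻ s in Ioi y, m s ∂ν := by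
    rw [← mul_setLIntegral_Ioi_rpow ν hγ (hV y (hx.trans hy)), mul_left_comm,
      ← lintegral_const_mul _ (hVm.pow_const _)]
    refine mul_le_mul_right (setLIntegral_mono' measurableSet_Ioi fun s hs => ?_) _
    exact mul_le_mul_left (ENNReal.rpow_le_rpow (hM (le_of_lt hs)) (by positivity)) _
  calc _ = (M y ^ (1 / (p - q)) * ν (Ioi y) ^ ((p - 1) / (p - q))) ^ q * μ (Ioc x y) ^ (q / r) := by
        rw [ENNReal.mul_rpow_of_nonneg _ _ hq.le, ← ENNReal.rpow_mul, ← ENNReal.rpow_mul,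
          one_div_mul_eq_div, div_mul_eq_mul_div, mul_comm]
    _ ≤ (ENNReal.ofReal ((p - 1) / (p - q)) * ∫⁻ s in Ioi y, m s ∂ν) ^ q *
          μ (Ioc x y) ^ (q / r) := by gcongr
    _ ≤ _ := by
        rw [ENNReal.mul_rpow_of_nonneg _ _ hq.le, mul_assoc]
        exact mul_le_mul_right (rpow_tail_mul_rpow_le hr hq.le) _

/-- The constant bounding the energy of the resolvent test function. -/
def resolventConstant (p q : ℝ) (D : ℝ≥0∞) : ℝ≥0∞ :=
  ENNReal.ofReal ((p - 1) / (p - q)) ^ q * (D *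
    (((ENNReal.ofReal ((p - 1) * q / (p - q)))⁻¹ * ENNReal.ofReal (1 + q / (p - q)) *
      (ENNReal.ofReal ((p - 1) / (p - q)) ^ q * D)) ^ (1 / (1 - q / p))) ^ (q / p))

theorem resolventConstant_ne_top (hD : D ≠ ∞) (hp : 1 < p) (hq : 0 < q) (hqp : q < p) :
    resolventConstant p q D ≠ ∞ := by
  have hp0 : 0 < p := by linarith
  have hpq : 0 < p - q := by linarith
  have hp1 : 0 < p - 1 := by linarith
  have hκ : 0 < (p - 1) * q / (p - q) := by positivity
  have h1 : 0 < 1 - q / p := sub_pos.2 ((div_lt_one hp0).2 hqp)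
  have hc : ENNReal.ofReal ((p - 1) / (p - q)) ^ q ≠ ∞ :=
    ENNReal.rpow_ne_top_of_nonneg hq.le ENNReal.ofReal_ne_top
  refine ENNReal.mul_ne_top hc (ENNReal.mul_ne_top hD (ENNReal.rpow_ne_top_of_nonneg (by positivity)
    (ENNReal.rpow_ne_top_of_nonneg (by positivity) (ENNReal.mul_ne_top (ENNReal.mul_ne_top ?_
      ENNReal.ofReal_ne_top) (ENNReal.mul_ne_top hc hD)))))
  simpa using hκ

theorem TailInequality.lintegral_kernelSup_resolventMeasure_le [IsFiniteMeasure ω]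
    [NullSingletonClass ω] [SFinite μ] [SFinite ν] [NullSingletonClass ν]
    (h : TailInequality ω μ ν p q r D) (hV : ∀ x, 0 < x → ν (Ioi x) ≠ ∞) (hp : 1 < p) (hq : 0 < q)
    (hr : 0 < r) (hqp : q < p) {a N : ℝ} (ha0 : 0 < a) (ha : ω (Iic a) = 0) (hN : ω (Ioi N) = 0)
    (hU : μ (Ioc a N) ≠ ∞) :
    ∫⁻ x, kernelSup μ (q / r) (fun y => resolventMeasure ω μ (q / r) (Iic y) ^ (q / (p - q)) *
      ν (Ioi y) ^ ((p - 1) * q / (p - q))) x ∂ω ≤ resolventConstant p q D := by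
  have hp0 : 0 < p := by linarith
  have hpq : 0 < p - q := by linarith
  have hp1 : 0 < p - 1 := by linarith
  have hα : 0 ≤ q / r := by positivity
  have hθ : 0 < q / (p - q) := by positivity
  have hκ : 0 < (p - 1) * q / (p - q) := by positivity
  set ρ := resolventMeasure ω μ (q / r) with hρ
  have : IsFiniteMeasure ρ := ⟨(resolventMeasure_univ_le hα ha hN).trans_lt (ENNReal.mul_lt_top
    (ENNReal.rpow_lt_top_of_nonneg hα hU) (measure_lt_top _ _))⟩
  have : NullSingletonClass ρ := by rw [hρ]; infer_instance
  have hω0 : ∀ᵐ x ∂ω, 0 < x := by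
    filter_upwards [ae_mem_Ioc ha hN] with x hx using ha0.trans hx.1
  have hac : ρ ≪ ω := withDensity_absolutelyContinuous _ _
  have hρ0 : ∀ᵐ x ∂ρ, 0 < x := hac.ae_le hω0
  have hMm := measurable_measure_Iic ρ
  have hVm := measurable_measure_Ioi ν
  set θ := q / (p - q)
  set κ := (p - 1) * q / (p - q)
  set Y := ∫⁻ z, ρ (Iic z) ^ (1 + θ) * ν (Ioi z) ^ (κ - 1) ∂ν with hY
  set X := ∫⁻ x, kernelSup μ (q / r) (fun y => ρ (Iic y) ^ θ * ν (Ioi y) ^ κ) x ∂ω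
  have hX : X ≤ ENNReal.ofReal ((p - 1) / (p - q)) ^ q * (D * Y ^ (q / p)) :=
    h.lintegral_kernelSup_le hω0 hV hp hq hr hqp fun s t hst => measure_mono (Iic_subset_Iic.2 hst)
  have hYt : Y ≠ ∞ := by
    have h1 : Y ≤ ρ univ ^ (1 + θ) * ((ENNReal.ofReal κ)⁻¹ * ν (Ioi a) ^ κ) := by
      rw [← mul_setLIntegral_Ioi_rpow ν hκ (hV a ha0), ← mul_assoc (ENNReal.ofReal κ)⁻¹,
        ENNReal.inv_mul_cancel (by simpa using hκ) ENNReal.ofReal_ne_top, one_mul,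
        ← lintegral_const_mul _ (hVm.pow_const _), ← lintegral_indicator measurableSet_Ioi]
      refine lintegral_mono fun z => ?_
      by_cases hz : a < z
      · rw [indicator_of_mem (mem_Ioi.2 hz)]
        gcongr
        exact subset_univ _
      · have : ρ (Iic z) = 0 := hac (measure_mono_null (Iic_subset_Iic.2 (not_lt.1 hz)) ha)
        rw [this, ENNReal.zero_rpow_of_pos (by positivity), zero_mul]
        exact zero_le
    refine ne_top_of_le_ne_top ?_ h1
    exact ENNReal.mul_ne_top (ENNReal.rpow_ne_top_of_nonneg (by positivity) (measure_ne_top _ _))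
      (ENNReal.mul_ne_top (by simpa using hκ)
        (ENNReal.rpow_ne_top_of_nonneg hκ.le (hV a ha0)))
  have hYX : Y ≤ (ENNReal.ofReal κ)⁻¹ * ENNReal.ofReal (1 + θ) * X := by
    calc Y = (ENNReal.ofReal κ)⁻¹ * (ENNReal.ofReal κ * Y) := by
          rw [← mul_assoc, ENNReal.inv_mul_cancel (by simpa using hκ) ENNReal.ofReal_ne_top,
            one_mul]
      _ ≤ _ := by
          rw [hY, mul_lintegral_rpow_mul_rpow_eq hρ0 hV hθ hκ, mul_assoc]
          gcongr
          exact lintegral_resolventMeasure_le hα ((hMm.pow_const _).mul (hVm.pow_const _))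
  have hYY : Y ≤ (ENNReal.ofReal κ)⁻¹ * ENNReal.ofReal (1 + θ) *
      (ENNReal.ofReal ((p - 1) / (p - q)) ^ q * D) * Y ^ (q / p) := by
    calc _ ≤ _ := hYX
      _ ≤ (ENNReal.ofReal κ)⁻¹ * ENNReal.ofReal (1 + θ) *
          (ENNReal.ofReal ((p - 1) / (p - q)) ^ q * (D * Y ^ (q / p))) := by gcongr
      _ = _ := by ring
  calc _ ≤ _ := hX
    _ ≤ _ := by
      unfold resolventConstant
      gcongr
      exact ENNReal.le_rpow_of_le_mul_rpow ((div_lt_one hp0).2 hqp) hYt hYY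

end ResolventTest

section PrimitiveNecessity

variable {ω μ ν : Measure ℝ} {p q r α θ : ℝ} {D : ℝ≥0∞} {φ : ℝ → ℝ≥0∞}

theorem kernelPrimitive_le_add (hα : 0 ≤ α) (hα1 : α ≤ 1) {x t : ℝ} (hxt : x ≤ t) :
    kernelPrimitive ω μ α t ≤ kernelPrimitive ω μ α x + ω (Iic t) * μ (Ioc x t) ^ α := by
  have h1 : ∫⁻ b in Ioc x t, μ (Ioc b t) ^ α ∂ω ≤ ω (Ioc x t) * μ (Ioc x t) ^ α := by
    rw [mul_comm, ← setLIntegral_const]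
    refine setLIntegral_mono' measurableSet_Ioc fun b hb => ?_
    gcongr
    exact hb.1.le
  calc kernelPrimitive ω μ α t = ∫⁻ b in Iic x, μ (Ioc b t) ^ α ∂ω +
        ∫⁻ b in Ioc x t, μ (Ioc b t) ^ α ∂ω := by
        rw [kernelPrimitive, ← Iic_union_Ioc_eq_Iic hxt,
          lintegral_union measurableSet_Ioc (Iic_disjoint_Ioc le_rfl)]
    _ ≤ kernelPrimitive ω μ α x + ω (Iic x) * μ (Ioc x t) ^ α +
          ω (Ioc x t) * μ (Ioc x t) ^ α :=
        add_le_add (setLIntegral_le_kernelPrimitive_add hα hα1 hxt) h1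
    _ = _ := by
        rw [← measure_Iic_add_measure_Ioc ω hxt]
        ring

theorem kernelPrimitive_rpow_mul_kernelSup_le (hα : 0 ≤ α) (hα1 : α ≤ 1) (hθ : 0 ≤ θ) {x t : ℝ}
    (hxt : x ≤ t) {M : ℝ → ℝ≥0∞} (hM : Monotone M) (hx : kernelPrimitive ω μ α x ≤ 4 * M t) :
    kernelPrimitive ω μ α t ^ θ * kernelSup μ α φ t ≤
      8 ^ θ * kernelSup μ α (fun y => M y ^ θ * φ y) t +
        2 ^ θ * ω (Iic t) ^ θ * kernelSup μ (α * (1 + θ)) φ x := by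
  have hsup : kernelPrimitive ω μ α t ^ θ * kernelSup μ α φ t =
      ⨆ y ∈ Ioi t, kernelPrimitive ω μ α t ^ θ * (μ (Ioc t y) ^ α * φ y) := by
    simp only [kernelSup, ENNReal.mul_iSup]
  rw [hsup]
  refine iSup₂_le fun y (hy : t < y) => ?_
  have hU : (μ (Ioc x t) ^ α) ^ θ * μ (Ioc t y) ^ α ≤ μ (Ioc x y) ^ (α * (1 + θ)) := by
    rw [mul_add, mul_one, add_comm, ENNReal.rpow_add_of_nonneg _ _ (by positivity) hα,
      ← ENNReal.rpow_mul]
    gcongr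
  have h8 : (8 : ℝ≥0∞) ^ θ = 2 ^ θ * 4 ^ θ := by
    rw [← ENNReal.mul_rpow_of_nonneg _ _ hθ]
    norm_num
  calc _ ≤ (4 * M t + ω (Iic t) * μ (Ioc x t) ^ α) ^ θ * (μ (Ioc t y) ^ α * φ y) := by
        gcongr
        exact (kernelPrimitive_le_add hα hα1 hxt).trans (add_le_add hx le_rfl)
    _ ≤ 2 ^ θ * ((4 * M t) ^ θ + (ω (Iic t) * μ (Ioc x t) ^ α) ^ θ) *
          (μ (Ioc t y) ^ α * φ y) := by
        gcongr
        exact ENNReal.add_rpow_le_two_rpow_mul _ _ hθ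
    _ = 8 ^ θ * (μ (Ioc t y) ^ α * (M t ^ θ * φ y)) + 2 ^ θ * ω (Iic t) ^ θ *
          ((μ (Ioc x t) ^ α) ^ θ * μ (Ioc t y) ^ α * φ y) := by
        rw [h8, ENNReal.mul_rpow_of_nonneg _ _ hθ, ENNReal.mul_rpow_of_nonneg _ _ hθ]
        ring
    _ ≤ 8 ^ θ * (μ (Ioc t y) ^ α * (M y ^ θ * φ y)) + 2 ^ θ * ω (Iic t) ^ θ *
          (μ (Ioc x y) ^ (α * (1 + θ)) * φ y) := by
        gcongr
        exact hM hy.le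
    _ ≤ _ := by
        gcongr
        · exact le_kernelSup (φ := fun y => M y ^ θ * φ y) hy
        · exact le_kernelSup (hxt.trans_lt hy)

theorem kernelPrimitive_rpow_mul_kernelSup_le_setLIntegral [IsFiniteMeasure ω]
    [NullSingletonClass ω] [SFinite μ] (hα : 0 ≤ α) (hα1 : α ≤ 1) (hθ : 0 ≤ θ) {t : ℝ}
    (ht : ω (Iic t) ≠ 0) (hS : kernelPrimitive ω μ α t ≠ ∞) :
    kernelPrimitive ω μ α t ^ θ * kernelSup μ α φ t ≤
      8 ^ θ * kernelSup μ α (fun y => resolventMeasure ω μ α (Iic y) ^ θ * φ y) t +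
        2 ^ θ * ENNReal.ofReal (θ + 2) * 2 ^ (θ + 2) * (ω (Iic t) ^ (-2 : ℝ) *
          ∫⁻ x in Iic t, ω (Iic x) ^ (1 + θ) * kernelSup μ (α * (1 + θ)) φ x ∂ω) := by
  have hW : ∀ t, ω (Iic t) ≠ ∞ := fun t => measure_ne_top _ _
  obtain ⟨s, hst, hs⟩ := exists_measure_Iic_eq ω (c := ω (Iic t) / 2) (by simpa using ht)
    ENNReal.half_le_self (hW t)
  have hWm : Measurable fun x => ω (Iic x) ^ (1 + θ) := (measurable_measure_Iic ω).pow_const _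
  have hS4 : kernelPrimitive ω μ α s ≤ 4 * resolventMeasure ω μ α (Iic t) :=
    kernelPrimitive_le_four_mul_resolventMeasure hα hα1 hst hs ht
      (ne_top_of_le_ne_top hS (kernelPrimitive_mono hα hst))
  set G := kernelPrimitive ω μ α t ^ θ * kernelSup μ α φ t
  set P := kernelSup μ α (fun y => resolventMeasure ω μ α (Iic y) ^ θ * φ y) t
  set Ψ := kernelSup μ (α * (1 + θ)) φ
  have hΨm : Measurable Ψ := measurable_kernelSup (by positivity)
  have hWΨ : Measurable fun x => ω (Iic x) ^ (1 + θ) * Ψ x := hWm.mul hΨm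
  have hpt : ∀ x ≤ s, G ≤ 8 ^ θ * P + 2 ^ θ * ω (Iic t) ^ θ * Ψ x := fun x hx =>
    kernelPrimitive_rpow_mul_kernelSup_le hα hα1 hθ (hx.trans hst)
      (fun a b hab => measure_mono (Iic_subset_Iic.2 hab)) ((kernelPrimitive_mono hα hx).trans hS4)
  have hI : ENNReal.ofReal (θ + 2) * ∫⁻ x in Iic s, ω (Iic x) ^ (1 + θ) ∂ω =
      (ω (Iic t) / 2) ^ (θ + 2) := by
    have := mul_setLIntegral_Iic_rpow ω (by linarith : 0 < θ + 2) (hW s)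
    rwa [show θ + 2 - 1 = 1 + θ by ring, hs] at this
  set I := ∫⁻ x in Iic s, ω (Iic x) ^ (1 + θ) ∂ω
  set J := ∫⁻ x in Iic t, ω (Iic x) ^ (1 + θ) * Ψ x ∂ω
  have hfint : G * I ≤ 8 ^ θ * P * I + 2 ^ θ * ω (Iic t) ^ θ * J := by
    calc _ = ∫⁻ x in Iic s, G * ω (Iic x) ^ (1 + θ) ∂ω := (lintegral_const_mul _ hWm).symm
      _ ≤ ∫⁻ x in Iic s, (8 ^ θ * P * ω (Iic x) ^ (1 + θ) +
          2 ^ θ * ω (Iic t) ^ θ * (ω (Iic x) ^ (1 + θ) * Ψ x)) ∂ω := by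
          refine setLIntegral_mono' measurableSet_Iic fun x hx => ?_
          calc _ ≤ _ := mul_le_mul_left (hpt x hx) _
            _ = _ := by ring
      _ = 8 ^ θ * P * I + 2 ^ θ * ω (Iic t) ^ θ *
          ∫⁻ x in Iic s, ω (Iic x) ^ (1 + θ) * Ψ x ∂ω := by
          rw [lintegral_add_left (hWm.const_mul _), lintegral_const_mul _ hWm,
            lintegral_const_mul _ hWΨ]
      _ ≤ _ := by
          gcongr
          exact lintegral_mono_set (Iic_subset_Iic.2 hst)
  have hcancel : ENNReal.ofReal (θ + 2) * 2 ^ (θ + 2) * ω (Iic t) ^ (-(θ + 2)) * I = 1 := by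
    have h2 : (2 : ℝ≥0∞) ^ (θ + 2) ≠ 0 := by simp [ENNReal.rpow_eq_zero_iff]
    have h2t : (2 : ℝ≥0∞) ^ (θ + 2) ≠ ∞ := ENNReal.rpow_ne_top_of_nonneg (by positivity) (by simp)
    calc _ = 2 ^ (θ + 2) * ω (Iic t) ^ (-(θ + 2)) * (ENNReal.ofReal (θ + 2) * I) := by ring
      _ = (2 ^ (θ + 2) * (2 ^ (θ + 2))⁻¹) * (ω (Iic t) ^ (-(θ + 2)) * ω (Iic t) ^ (θ + 2)) := by
          rw [hI, ENNReal.div_rpow_of_nonneg _ _ (by positivity), div_eq_mul_inv]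
          ring
      _ = 1 := by
          rw [ENNReal.mul_inv_cancel h2 h2t, ← ENNReal.rpow_add _ _ ht (hW t), neg_add_cancel,
            ENNReal.rpow_zero, one_mul]
  calc G = G * I * (ENNReal.ofReal (θ + 2) * 2 ^ (θ + 2) * ω (Iic t) ^ (-(θ + 2))) := by
        rw [mul_assoc, mul_comm I, hcancel, mul_one]
    _ ≤ (8 ^ θ * P * I + 2 ^ θ * ω (Iic t) ^ θ * J) *
          (ENNReal.ofReal (θ + 2) * 2 ^ (θ + 2) * ω (Iic t) ^ (-(θ + 2))) := by gcongr
    _ = 8 ^ θ * P * (ENNReal.ofReal (θ + 2) * 2 ^ (θ + 2) * ω (Iic t) ^ (-(θ + 2)) * I) +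
          2 ^ θ * ENNReal.ofReal (θ + 2) * 2 ^ (θ + 2) *
            ((ω (Iic t) ^ θ * ω (Iic t) ^ (-(θ + 2))) * J) := by ring
    _ = _ := by
        rw [hcancel, mul_one, ← ENNReal.rpow_add _ _ ht (hW t),
          show θ + -(θ + 2) = -2 by ring]

namespace TailInequality

theorem lintegral_kernelPrimitive_rpow_mul_kernelSup_le [IsFiniteMeasure ω]
    [NullSingletonClass ω] [SFinite μ] [SFinite ν] [NullSingletonClass ν]
    (h : TailInequality ω μ ν p q r D) (hV : ∀ x, 0 < x → ν (Ioi x) ≠ ∞) (hp : 1 < p) (hq : 0 < q)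
    (hr : 0 < r) (hqp : q < p) (hqr : q ≤ r) {a N : ℝ} (ha0 : 0 < a) (ha : ω (Iic a) = 0)
    (hN : ω (Ioi N) = 0) (hU : μ (Ioc a N) ≠ ∞) :
    ∫⁻ t, kernelPrimitive ω μ (q / r) t ^ (q / (p - q)) *
        kernelSup μ (q / r) (fun y => ν (Ioi y) ^ ((p - 1) * q / (p - q))) t ∂ω ≤
      8 ^ (q / (p - q)) * resolventConstant p q D +
        2 ^ (q / (p - q)) * ENNReal.ofReal (q / (p - q) + 2) * 2 ^ (q / (p - q) + 2) *
          ∫⁻ t, ω (Iic t) ^ (q / (p - q)) * kernelSup μ (q / r * (1 + q / (p - q)))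
            (fun y => ν (Ioi y) ^ ((p - 1) * q / (p - q))) t ∂ω := by
  have hpq : 0 < p - q := by linarith
  have hα : 0 ≤ q / r := by positivity
  have hα1 : q / r ≤ 1 := (div_le_one hr).2 hqr
  have hθ : 0 ≤ q / (p - q) := by positivity
  have hW : ∀ t, ω (Iic t) ≠ ∞ := fun t => measure_ne_top _ _
  have hWm := measurable_measure_Iic ω
  have hres := h.lintegral_kernelSup_resolventMeasure_le hV hp hq hr hqp ha0 ha hN hU
  set φ : ℝ → ℝ≥0∞ := fun y => ν (Ioi y) ^ ((p - 1) * q / (p - q))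
  set θ := q / (p - q)
  set α := q / r
  have hΨm : Measurable (kernelSup μ (α * (1 + θ)) φ) := measurable_kernelSup (by positivity)
  have hg : Measurable fun x => ω (Iic x) ^ (1 + θ) * kernelSup μ (α * (1 + θ)) φ x :=
    (hWm.pow_const _).mul hΨm
  have hPm : Measurable (kernelSup μ α fun y => resolventMeasure ω μ α (Iic y) ^ θ * φ y) :=
    measurable_kernelSup hα
  have hJ := lintegral_rpow_neg_two_mul_setLIntegral_le hW
    (f := fun x _ => ω (Iic x) ^ (1 + θ) * kernelSup μ (α * (1 + θ)) φ x) (hg.comp measurable_fst)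
    (g := fun x => ω (Iic x) ^ θ * kernelSup μ (α * (1 + θ)) φ x)
    (.of_forall fun x t _ => by
      rw [ENNReal.rpow_add_of_nonneg _ _ zero_le_one hθ, ENNReal.rpow_one, mul_assoc])
  calc _ ≤ ∫⁻ t, (8 ^ θ * kernelSup μ α (fun y => resolventMeasure ω μ α (Iic y) ^ θ * φ y) t +
        2 ^ θ * ENNReal.ofReal (θ + 2) * 2 ^ (θ + 2) * (ω (Iic t) ^ (-2 : ℝ) *
          ∫⁻ x in Iic t, ω (Iic x) ^ (1 + θ) * kernelSup μ (α * (1 + θ)) φ x ∂ω)) ∂ω := by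
        refine lintegral_mono_ae ?_
        filter_upwards [ae_mem_Ioc ha hN, ae_measure_Iic_ne_zero hW] with t ht ht0
        exact kernelPrimitive_rpow_mul_kernelSup_le_setLIntegral hα hα1 hθ ht0
          (kernelPrimitive_ne_top_of_measure_Ioc hα ha hU ht.2)
    _ = _ := by
        rw [lintegral_add_left (hPm.const_mul _), lintegral_const_mul _ hPm, lintegral_const_mul']
        exact ENNReal.mul_ne_top (ENNReal.mul_ne_top (ENNReal.rpow_ne_top_of_nonneg hθ (by simp))
          ENNReal.ofReal_ne_top) (ENNReal.rpow_ne_top_of_nonneg (by positivity) (by simp))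
    _ ≤ _ := by gcongr

theorem restrict (h : TailInequality ω μ ν p q r D) (s : Set ℝ) :
    TailInequality (ω.restrict s) μ ν p q r D := fun m hm =>
  (setLIntegral_le_lintegral _ _).trans (h m hm)

end TailInequality

end PrimitiveNecessity

section Truncation

variable {ω μ ν : Measure ℝ} {p q r α θ : ℝ} {D : ℝ≥0∞}

theorem ENNReal.iSup_rpow {ι : Sort*} (f : ι → ℝ≥0∞) (hθ : 0 < θ) :
    (⨆ i, f i) ^ θ = ⨆ i, f i ^ θ :=
  (ENNReal.orderIsoRpow θ hθ).map_iSup f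

/-- The half-open intervals `(1 / (n + 1), n + 1]` exhausting `(0, ∞)`. -/
def exhaustingIoc (n : ℕ) : Set ℝ := Ioc (1 / ((n : ℝ) + 1)) (n + 1)

theorem exhaustingIoc_mono : Monotone exhaustingIoc := fun m n hmn => by
  have : (m : ℝ) ≤ n := by exact_mod_cast hmn
  exact Ioc_subset_Ioc (one_div_le_one_div_of_le (by positivity) (by linarith)) (by linarith)

theorem iUnion_exhaustingIoc : ⋃ n, exhaustingIoc n = Ioi 0 := by
  ext x
  simp only [mem_iUnion, exhaustingIoc, mem_Ioc, mem_Ioi]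
  refine ⟨fun ⟨n, hn, _⟩ => lt_trans (by positivity) hn, fun hx => ?_⟩
  obtain ⟨m, hm⟩ := exists_nat_one_div_lt hx
  obtain ⟨k, hk⟩ := exists_nat_ge x
  have hmk : (m : ℝ) ≤ (max m k : ℕ) := by exact_mod_cast le_max_left m k
  have hkm : (k : ℝ) ≤ (max m k : ℕ) := by exact_mod_cast le_max_right m k
  exact ⟨max m k, (one_div_le_one_div_of_le (by positivity) (by linarith)).trans_lt hm,
    by linarith⟩

theorem lintegral_eq_iSup_exhaustingIoc (hω : ∀ᵐ x ∂ω, 0 < x) (f : ℝ → ℝ≥0∞) :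
    ∫⁻ x, f x ∂ω = ⨆ n, ∫⁻ x in exhaustingIoc n, f x ∂ω := by
  have : ω.restrict (Ioi 0) = ω := Measure.restrict_eq_self_of_ae_mem hω
  rw [← setLIntegral_iUnion_of_directed _ exhaustingIoc_mono.directed_le, iUnion_exhaustingIoc,
    this]

theorem kernelPrimitive_eq_iSup (hω : ∀ᵐ x ∂ω, 0 < x) (t : ℝ) :
    kernelPrimitive ω μ α t = ⨆ n, kernelPrimitive (ω.restrict (exhaustingIoc n)) μ α t := by
  rw [kernelPrimitive, lintegral_eq_iSup_exhaustingIoc (ae_restrict_of_ae hω)]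
  refine iSup_congr fun n => ?_
  rw [kernelPrimitive, Measure.restrict_comm measurableSet_Iic]

theorem kernelPrimitive_mono_measure {ω' : Measure ℝ} (h : ω ≤ ω') (t : ℝ) :
    kernelPrimitive ω μ α t ≤ kernelPrimitive ω' μ α t :=
  lintegral_mono' (Measure.restrict_mono le_rfl h) le_rfl

theorem TailInequality.lintegral_kernelPrimitive_rpow_mul_kernelSup_ne_top [NullSingletonClass ω]
    [SFinite μ] [SFinite ν] [NullSingletonClass ν] (h : TailInequality ω μ ν p q r D) (hD : D ≠ ∞)
    (hω : IsPositiveOnIoi ω) (hμ : IsPositiveOnIoi μ) (hν : IsPositiveOnIoi ν)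
    (hV : ∀ x, 0 < x → ν (Ioi x) ≠ ∞) (hp : 1 < p) (hq : 0 < q) (hr : 0 < r) (hqp : q < p)
    (hqr : q ≤ r) :
    ∫⁻ t, kernelPrimitive ω μ (q / r) t ^ (q / (p - q)) *
      kernelSup μ (q / r) (fun y => ν (Ioi y) ^ ((p - 1) * q / (p - q))) t ∂ω ≠ ∞ := by
  have hpq : 0 < p - q := by linarith
  have hα : 0 ≤ q / r := by positivity
  have hθ0 : 0 < q / (p - q) := by positivity
  have hθ := hθ0.le
  have hE := h.lintegral_rpow_mul_kernelSup_ne_top hD hω hμ hν hV hp hq hr hqp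
  have hcon := resolventConstant_ne_top hD hp hq hqp
  have hW := h.measure_Iic_ne_top hD hμ hν hV hp hq hr
  have hU : ∀ n : ℕ, μ (exhaustingIoc n) ≠ ∞ := fun n =>
    h.measure_Ioc_ne_top hD hν hV hp hq hr _ (hω.Iic_ne_zero (by positivity)) (by positivity)
  have hbase : ∀ n : ℕ, _ := fun n =>
    have : IsFiniteMeasure (ω.restrict (exhaustingIoc n)) :=
      isFiniteMeasure_restrict.2 (ne_top_of_le_ne_top (hW _) (measure_mono Ioc_subset_Iic_self))
    (h.restrict (exhaustingIoc n)).lintegral_kernelPrimitive_rpow_mul_kernelSup_le hV hp hq hr hqp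
      hqr (a := 1 / ((n : ℝ) + 1)) (by positivity)
      (by rw [Measure.restrict_apply measurableSet_Iic, exhaustingIoc,
        (Iic_disjoint_Ioc le_rfl).inter_eq, measure_empty])
      (by rw [Measure.restrict_apply measurableSet_Ioi, exhaustingIoc, inter_comm,
        (Ioc_disjoint_Ioi le_rfl).inter_eq, measure_empty])
      (hU n)
  set φ : ℝ → ℝ≥0∞ := fun y => ν (Ioi y) ^ ((p - 1) * q / (p - q))
  set θ := q / (p - q)
  set α := q / r
  set K := 8 ^ θ * resolventConstant p q D + 2 ^ θ * ENNReal.ofReal (θ + 2) * 2 ^ (θ + 2) *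
    ∫⁻ t, ω (Iic t) ^ θ * kernelSup μ (α * (1 + θ)) φ t ∂ω
  have hK : K ≠ ∞ := by
    have h2 : ∀ x : ℝ, 0 ≤ x → (2 : ℝ≥0∞) ^ x ≠ ∞ := fun x hx =>
      ENNReal.rpow_ne_top_of_nonneg hx (by simp)
    exact ENNReal.add_ne_top.2
      ⟨ENNReal.mul_ne_top (ENNReal.rpow_ne_top_of_nonneg hθ (by simp)) hcon,
        ENNReal.mul_ne_top (ENNReal.mul_ne_top (ENNReal.mul_ne_top (h2 _ hθ)
          ENNReal.ofReal_ne_top) (h2 _ (by positivity))) hE⟩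
  have hn : ∀ n : ℕ, ∫⁻ t in exhaustingIoc n,
      kernelPrimitive (ω.restrict (exhaustingIoc n)) μ α t ^ θ * kernelSup μ α φ t ∂ω ≤ K :=
    fun n => (hbase n).trans <| by
      refine add_le_add le_rfl (mul_le_mul_right ?_ _)
      refine (lintegral_mono fun t => ?_).trans (setLIntegral_le_lintegral (exhaustingIoc n) _)
      gcongr
      exact Measure.restrict_le_self
  have hsup : ∀ t, kernelPrimitive ω μ α t ^ θ * kernelSup μ α φ t =
      ⨆ k, kernelPrimitive (ω.restrict (exhaustingIoc k)) μ α t ^ θ * kernelSup μ α φ t :=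
    fun t => by rw [kernelPrimitive_eq_iSup hω.ae_pos, ENNReal.iSup_rpow _ hθ0, ENNReal.iSup_mul]
  have hmono : ∀ t, Monotone fun k => kernelPrimitive (ω.restrict (exhaustingIoc k)) μ α t ^ θ *
      kernelSup μ α φ t := fun t j k hjk => by
    dsimp only
    gcongr
    exact kernelPrimitive_mono_measure (Measure.restrict_mono (exhaustingIoc_mono hjk) le_rfl) t
  refine ne_top_of_le_ne_top hK ?_
  simp_rw [hsup]
  have hmeas : ∀ k, Measurable fun t =>
      kernelPrimitive (ω.restrict (exhaustingIoc k)) μ α t ^ θ * kernelSup μ α φ t := fun k =>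
    ((measurable_kernelPrimitive hα).pow_const _).mul (measurable_kernelSup hα)
  rw [lintegral_iSup hmeas (fun j k hjk t => hmono t hjk)]
  refine iSup_le fun k => ?_
  rw [lintegral_eq_iSup_exhaustingIoc hω.ae_pos]
  refine iSup_le fun n => ?_
  calc _ ≤ _ := lintegral_mono_set (exhaustingIoc_mono (le_max_right k n))
    _ ≤ _ := lintegral_mono fun t => hmono t (le_max_left k n)
    _ ≤ K := hn _

end Truncation

section Weights

variable {u v w h m : ℝ → ℝ≥0∞} {p q r : ℝ}

instance : SFinite mu0 := by
  unfold mu0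
  infer_instance

instance : NullSingletonClass mu0 := by
  unfold mu0
  infer_instance

instance : NullSingletonClass (mu0.withDensity w) :=
  ⟨fun x => withDensity_absolutelyContinuous _ _ (measure_singleton x)⟩

namespace IsWeight

theorem lintegral_withDensity (hw : IsWeight w) (f : ℝ → ℝ≥0∞) :
    ∫⁻ x, f x ∂mu0.withDensity w = ∫⁻ x in Ioi 0, w x * f x :=
  lintegral_withDensity_eq_lintegral_mul_non_measurable _ hw.1 (hw.2.mono fun _ hx => hx.2) f

theorem setLIntegral_withDensity (hw : IsWeight w) {s : Set ℝ} (hs : MeasurableSet s)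
    (f : ℝ → ℝ≥0∞) :
    ∫⁻ x in s, f x ∂mu0.withDensity w = ∫⁻ x in s ∩ Ioi 0, w x * f x := by
  rw [setLIntegral_withDensity_eq_setLIntegral_mul_non_measurable _ hw.1 _ hs
    (ae_restrict_of_ae (hw.2.mono fun _ hx => hx.2)), mu0, Measure.restrict_restrict hs]
  rfl

theorem setLIntegral_Ioi (hw : IsWeight w) {a : ℝ} (ha : 0 ≤ a) (f : ℝ → ℝ≥0∞) :
    ∫⁻ x in Ioi a, f x ∂mu0.withDensity w = ∫⁻ x in Ioi a, w x * f x := by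
  rw [hw.setLIntegral_withDensity measurableSet_Ioi, inter_eq_left.2 (Ioi_subset_Ioi ha)]

theorem setLIntegral_Iic (hw : IsWeight w) (b : ℝ) (f : ℝ → ℝ≥0∞) :
    ∫⁻ x in Iic b, f x ∂mu0.withDensity w = ∫⁻ x in Ioc 0 b, w x * f x := by
  rw [hw.setLIntegral_withDensity measurableSet_Iic, Iic_inter_Ioi]

theorem setLIntegral_Ioc (hw : IsWeight w) {a : ℝ} (ha : 0 ≤ a) (b : ℝ) (f : ℝ → ℝ≥0∞) :
    ∫⁻ x in Ioc a b, f x ∂mu0.withDensity w = ∫⁻ x in Ioc a b, w x * f x := by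
  rw [hw.setLIntegral_withDensity measurableSet_Ioc,
    inter_eq_left.2 (Ioc_subset_Ioi_self.trans (Ioi_subset_Ioi ha))]

theorem measure_Ioi (hw : IsWeight w) {a : ℝ} (ha : 0 ≤ a) :
    mu0.withDensity w (Ioi a) = ∫⁻ x in Ioi a, w x := by
  simpa using hw.setLIntegral_Ioi ha fun _ => 1

theorem measure_Iic (hw : IsWeight w) (b : ℝ) :
    mu0.withDensity w (Iic b) = ∫⁻ x in Ioc 0 b, w x := by
  simpa using hw.setLIntegral_Iic b fun _ => 1

theorem measure_Ioc (hw : IsWeight w) {a : ℝ} (ha : 0 ≤ a) (b : ℝ) :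
    mu0.withDensity w (Ioc a b) = ∫⁻ x in Ioc a b, w x := by
  simpa using hw.setLIntegral_Ioc ha b fun _ => 1

theorem isPositiveOnIoi (hw : IsWeight w) : IsPositiveOnIoi (mu0.withDensity w) where
  Iic_zero := by simp [hw.measure_Iic]
  Ioc_ne_zero a b ha hab := by
    have hpos : ∀ᵐ x ∂volume.restrict (Ioc a b), 0 < w x :=
      (ae_restrict_of_ae_restrict_of_subset (Ioc_subset_Ioi_self.trans (Ioi_subset_Ioi ha))
        hw.2).mono fun _ hx => hx.1
    rw [hw.measure_Ioc ha, Ne, lintegral_eq_zero_iff hw.1]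
    intro h0
    have hF : ∀ᵐ _ ∂volume.restrict (Ioc a b), False := by
      filter_upwards [hpos, h0] with x h1 h2
      exact h1.ne' h2
    have : volume (Ioc a b) = 0 := by simpa only [ae_iff, not_false_eq_true, ofPred_true,
      Measure.restrict_apply_univ] using hF
    simp [hab.not_ge] at this

theorem rpow (hv : IsWeight v) (a : ℝ) : IsWeight fun x => v x ^ a :=
  ⟨hv.1.pow_const a, hv.2.mono fun _ hx =>
    ⟨ENNReal.rpow_pos hx.1 hx.2.ne, (ENNReal.rpow_ne_top_of_ne_zero hx.1.ne' hx.2.ne).lt_top⟩⟩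

theorem lintegral_iterated_tail (hu : IsWeight u) (hw : IsWeight w) (hv : IsWeight v)
    (hm : ∀ᵐ x ∂mu0, h x = v x * m x) :
    ∫⁻ x in Ioi (0 : ℝ),
        (∫⁻ t in Ioi x, (∫⁻ s in Ioi t, h s) ^ r * u t) ^ (q / r) * w x =
      ∫⁻ x, (∫⁻ t in Ioi x, (∫⁻ s in Ioi t, m s ∂mu0.withDensity v) ^ r
        ∂mu0.withDensity u) ^ (q / r) ∂mu0.withDensity w := by
  rw [hw.lintegral_withDensity]
  refine setLIntegral_congr_fun measurableSet_Ioi fun x (hx : 0 < x) => ?_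
  rw [mul_comm, hu.setLIntegral_Ioi hx.le]
  congr 2
  refine setLIntegral_congr_fun measurableSet_Ioi fun t (ht : x < t) => ?_
  have ht0 := hx.le.trans ht.le
  rw [mul_comm, hv.setLIntegral_Ioi ht0]
  congr 2
  exact lintegral_congr_ae (ae_restrict_of_ae_restrict_of_subset (Ioi_subset_Ioi ht0) hm)

theorem lintegral_rpow_mul (hv : IsWeight v) (hp : 1 < p)
    (hm : ∀ᵐ x ∂mu0, h x = v x ^ (1 - p / (p - 1)) * m x) :
    ∫⁻ t in Ioi (0 : ℝ), h t ^ p * v t =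
      ∫⁻ t, m t ^ p ∂mu0.withDensity fun x => v x ^ (1 - p / (p - 1)) := by
  have hp1 : 0 < p - 1 := by linarith
  rw [(hv.rpow _).lintegral_withDensity]
  refine lintegral_congr_ae ?_
  filter_upwards [hm, hv.2] with x hx hvx
  rw [hx, ENNReal.mul_rpow_of_nonneg _ _ (by linarith), ← ENNReal.rpow_mul, mul_right_comm]
  congr 1
  nth_rewrite 2 [← ENNReal.rpow_one (v x)]
  rw [← ENNReal.rpow_add _ _ hvx.1.ne' hvx.2.ne]
  congr 1
  field_simp
  ring

theorem exists_tailInequality_iff (hu : IsWeight u) (hw : IsWeight w) (hv : IsWeight v)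
    (hp : 1 < p) (hq : 0 < q) :
    (∃ C : ℝ≥0, 0 < C ∧ ∀ h : ℝ → ℝ≥0∞, Measurable h →
        (∫⁻ x in Ioi (0 : ℝ),
            (∫⁻ t in Ioi x, (∫⁻ s in Ioi t, h s) ^ r * u t) ^ (q / r) * w x) ^ (1 / q) ≤
          (C : ℝ≥0∞) * (∫⁻ t in Ioi (0 : ℝ), h t ^ p * v t) ^ (1 / p)) ↔
      ∃ D : ℝ≥0∞, D ≠ ∞ ∧ TailInequality (mu0.withDensity w) (mu0.withDensity u)
        (mu0.withDensity fun x => v x ^ (1 - p / (p - 1))) p q r D := by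
  have hσ := hv.rpow (1 - p / (p - 1))
  have hpow : ∀ (C : ℝ≥0) (Y : ℝ≥0∞),
      ((C : ℝ≥0∞) * Y ^ (1 / p)) ^ q = (C : ℝ≥0∞) ^ q * Y ^ (q / p) := fun C Y => by
    rw [ENNReal.mul_rpow_of_nonneg _ _ hq.le, ← ENNReal.rpow_mul, one_div_mul_eq_div]
  constructor
  · rintro ⟨C, -, hC⟩
    refine ⟨C ^ q, ENNReal.rpow_ne_top_of_nonneg hq.le ENNReal.coe_ne_top, fun m hm => ?_⟩
    have h1 := hC (fun x => v x ^ (1 - p / (p - 1)) * m x) (hσ.1.mul hm)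
    rw [hu.lintegral_iterated_tail hw hσ (m := m) (.of_forall fun _ => rfl),
      hv.lintegral_rpow_mul hp (m := m) (.of_forall fun _ => rfl),
      one_div q, ENNReal.rpow_inv_le_iff hq, hpow] at h1
    exact h1
  · rintro ⟨D, hD, hT⟩
    have hD' : D ^ (1 / q) ≠ ∞ := ENNReal.rpow_ne_top_of_nonneg (by positivity) hD
    refine ⟨(D ^ (1 / q)).toNNReal + 1, by positivity, fun h hh => ?_⟩
    have hm : ∀ᵐ x ∂mu0, h x = v x ^ (1 - p / (p - 1)) * (h x / v x ^ (1 - p / (p - 1))) := by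
      filter_upwards [hσ.2] with x hx
      exact (ENNReal.mul_div_cancel hx.1.ne' hx.2.ne).symm
    rw [hu.lintegral_iterated_tail hw hσ hm, hv.lintegral_rpow_mul hp hm,
      one_div q, ENNReal.rpow_inv_le_iff hq, hpow]
    refine (hT (fun x => h x / v x ^ (1 - p / (p - 1))) (hh.div hσ.1)).trans ?_
    gcongr
    rw [← ENNReal.rpow_inv_le_iff hq, ← one_div, ENNReal.coe_add, ENNReal.coe_toNNReal hD']
    exact le_self_add

theorem kernelSup_eq (hu : IsWeight u) (hv : IsWeight v) (α κ : ℝ) {t : ℝ} (ht : 0 ≤ t) :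
    kernelSup (mu0.withDensity u) α (fun y => mu0.withDensity v (Ioi y) ^ κ) t =
      ⨆ y ∈ Ioi t, (∫⁻ τ in Ioc t y, u τ) ^ α * (∫⁻ τ in Ioi y, v τ) ^ κ :=
  iSup_congr fun y => iSup_congr fun hy => by
    simp only [hu.measure_Ioc ht, hv.measure_Ioi (ht.trans (mem_Ioi.1 hy).le)]

theorem kernelPrimitive_eq (hw : IsWeight w) (hu : IsWeight u) (α t : ℝ) :
    kernelPrimitive (mu0.withDensity w) (mu0.withDensity u) α t =
      ∫⁻ s in Ioc (0 : ℝ) t, w s * (∫⁻ τ in Ioc s t, u τ) ^ α := by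
  rw [kernelPrimitive, hw.setLIntegral_Iic]
  refine setLIntegral_congr_fun measurableSet_Ioc fun s hs => ?_
  rw [hu.measure_Ioc hs.1.le]

end IsWeight

end Weights

theorem statement17 (p q r : ℝ) (hq : 0 < q) (hr : 0 < r) (hp : 1 < p) (hqp : q < p) (hpr : p ≤ r)
    (u w v : ℝ → ℝ≥0∞) (hu : IsWeight u) (hw : IsWeight w) (hv : IsWeight v)
    (hvfin : ∀ x ∈ Ioi (0 : ℝ), (∫⁻ t in Ioi x, v t ^ (1 - p / (p - 1))) < ∞) :
    (∃ C : ℝ≥0, 0 < C ∧ ∀ h : ℝ → ℝ≥0∞, Measurable h →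
        (∫⁻ x in Ioi (0 : ℝ),
            (∫⁻ t in Ioi x, (∫⁻ s in Ioi t, h s) ^ r * u t) ^ (q / r) * w x) ^
          (1 / q) ≤
          (C : ℝ≥0∞) * (∫⁻ t in Ioi (0 : ℝ), h t ^ p * v t) ^ (1 / p)) ↔
      (((∫⁻ t in Ioi (0 : ℝ),
        (∫⁻ s in Ioc (0 : ℝ) t, w s) ^ (q / (p - q)) * w t *
          (⨆ x ∈ Ioi t, (∫⁻ τ in Ioc t x, u τ) ^ (1 / r) *
              (∫⁻ τ in Ioi x, v τ ^ (1 - p / (p - 1))) ^ ((p - 1) / p)) ^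
            (p * q / (p - q))) ^ ((p - q) / (p * q))) < ∞ ∧
      ((∫⁻ t in Ioi (0 : ℝ),
        (∫⁻ s in Ioc (0 : ℝ) t, w s * (∫⁻ τ in Ioc s t, u τ) ^ (q / r)) ^ (q / (p - q)) *
          (w t *
            ⨆ x ∈ Ioi t, (∫⁻ τ in Ioc t x, u τ) ^ (q / r) *
              (∫⁻ τ in Ioi x, v τ ^ (1 - p / (p - 1))) ^ ((p - 1) * q / (p - q)))) ^
        ((p - q) / (p * q))) < ∞) := by
  have hp0 : 0 < p := by linarith
  have hpq : 0 < p - q := by linarith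
  have hσ := hv.rpow (1 - p / (p - 1))
  have hexp : 0 < (p - q) / (p * q) := by positivity
  have hα : 0 ≤ q / r := by positivity
  have hθ : 0 ≤ q / (p - q) := by positivity
  rw [hu.exists_tailInequality_iff hw hv hp hq, ENNReal.rpow_lt_top_iff_of_pos hexp,
    ENNReal.rpow_lt_top_iff_of_pos hexp]
  have hV : ∀ x : ℝ, 0 < x →
      (mu0.withDensity fun x => v x ^ (1 - p / (p - 1))) (Ioi x) ≠ ∞ := fun x hx => by
    rw [hσ.measure_Ioi hx.le]
    exact (hvfin x hx).ne
  have hE2 : ∫⁻ t in Ioi (0 : ℝ),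
      (∫⁻ s in Ioc (0 : ℝ) t, w s) ^ (q / (p - q)) * w t *
        (⨆ x ∈ Ioi t, (∫⁻ τ in Ioc t x, u τ) ^ (1 / r) *
            (∫⁻ τ in Ioi x, v τ ^ (1 - p / (p - 1))) ^ ((p - 1) / p)) ^ (p * q / (p - q)) =
      ∫⁻ t, mu0.withDensity w (Iic t) ^ (q / (p - q)) *
        kernelSup (mu0.withDensity u) (q / r * (1 + q / (p - q)))
          (fun y => (mu0.withDensity fun x => v x ^ (1 - p / (p - 1))) (Ioi y) ^
            ((p - 1) * q / (p - q))) t ∂mu0.withDensity w := by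
    rw [hw.lintegral_withDensity]
    refine setLIntegral_congr_fun measurableSet_Ioi fun t (ht : 0 < t) => ?_
    rw [hw.measure_Iic, hu.kernelSup_eq hσ _ _ ht.le, mul_right_comm, mul_comm]
    congr 2
    rw [ENNReal.iSup_rpow _ (by positivity)]
    refine iSup_congr fun x => ?_
    rw [ENNReal.iSup_rpow _ (by positivity)]
    refine iSup_congr fun _ => ?_
    rw [ENNReal.mul_rpow_of_nonneg _ _ (by positivity), ← ENNReal.rpow_mul, ← ENNReal.rpow_mul]
    congr 2
    · field_simp
      ring
    · field_simp
  have hE3 : ∫⁻ t in Ioi (0 : ℝ),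
      (∫⁻ s in Ioc (0 : ℝ) t, w s * (∫⁻ τ in Ioc s t, u τ) ^ (q / r)) ^ (q / (p - q)) *
        (w t * ⨆ x ∈ Ioi t, (∫⁻ τ in Ioc t x, u τ) ^ (q / r) *
            (∫⁻ τ in Ioi x, v τ ^ (1 - p / (p - 1))) ^ ((p - 1) * q / (p - q))) =
      ∫⁻ t, kernelPrimitive (mu0.withDensity w) (mu0.withDensity u) (q / r) t ^ (q / (p - q)) *
        kernelSup (mu0.withDensity u) (q / r)
          (fun y => (mu0.withDensity fun x => v x ^ (1 - p / (p - 1))) (Ioi y) ^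
            ((p - 1) * q / (p - q))) t ∂mu0.withDensity w := by
    rw [hw.lintegral_withDensity]
    refine setLIntegral_congr_fun measurableSet_Ioi fun t (ht : 0 < t) => ?_
    rw [hw.kernelPrimitive_eq hu, hu.kernelSup_eq hσ _ _ ht.le, mul_left_comm]
  rw [hE2, hE3, lt_top_iff_ne_top, lt_top_iff_ne_top]
  constructor
  · rintro ⟨D, hD, hT⟩
    exact ⟨hT.lintegral_rpow_mul_kernelSup_ne_top hD hw.isPositiveOnIoi hu.isPositiveOnIoi
        hσ.isPositiveOnIoi hV hp hq hr hqp,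
      hT.lintegral_kernelPrimitive_rpow_mul_kernelSup_ne_top hD hw.isPositiveOnIoi
        hu.isPositiveOnIoi hσ.isPositiveOnIoi hV hp hq hr hqp (hqp.le.trans hpr)⟩
  · rintro ⟨h2, h3⟩
    refine exists_tail_inequality_of_sufficiencyDensity hw.isPositiveOnIoi hu.isPositiveOnIoi
      hσ.isPositiveOnIoi hq hp hqp hpr hV ?_
    have hS : Measurable fun t =>
        kernelPrimitive (mu0.withDensity w) (mu0.withDensity u) (q / r) t ^ (q / (p - q)) *
          kernelSup (mu0.withDensity u) (q / r)
            (fun y => (mu0.withDensity fun x => v x ^ (1 - p / (p - 1))) (Ioi y) ^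
              ((p - 1) * q / (p - q))) t :=
      ((measurable_kernelPrimitive hα).pow_const _).mul (measurable_kernelSup hα)
    unfold sufficiencyDensity
    rw [lintegral_add_left hS]
    exact ENNReal.add_ne_top.2 ⟨h3, h2⟩
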